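/- Let ℓ be a prime. The only solution in integers x ≥ 1, y to the equation (x+1)³ + (x+2)³ + (x+3)³ + (x+4)³ = yˡ is (x, y, ℓ) = (10, 20, 3), i.e. 11³ + 12³ + 13³ + 14³ = 20³. -/

import Mathlib

/-- Powers of an element congruent to one modulo an odd number, to first order. -/
lemma exists_one_add_mul_pow {R : Type*} [CommRing R] {p : ℕ} (hp : Odd p) (κ : R) (v u : ℕ) :
    ∃ ρ : R, (1 + p * κ) ^ (p ^ v * u) = 1 + p ^ (v + 1) * (u * κ) + p ^ (v + 2) * ρ := by
  have h1 : ∃ ρ : R, (1 + p * κ) ^ (p ^ v) = 1 + p ^ (v + 1) * κ + p ^ (v + 2) * ρ := by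
    induction v with
    | zero => exact ⟨0, by simp⟩
    | succ v ih =>
      obtain ⟨ρ, h⟩ := ih
      obtain ⟨c, hc⟩ := odd_sq_dvd_geom_sum₂_sub (R := R) (p ^ v * (κ + p * ρ)) (a := 1) hp
      have hg := Commute.geom_sum₂_mul (Commute.one_right (1 + p * (p ^ v * (κ + p * ρ)) : R)) p
      refine ⟨ρ + (κ + p * ρ) * c, ?_⟩
      simp only [one_pow, mul_one] at hc hg
      rw [pow_succ p v, pow_mul, h]
      have e1 : (1 + p ^ (v + 1) * κ + p ^ (v + 2) * ρ : R) = 1 + p * (p ^ v * (κ + p * ρ)) := by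
        ring
      rw [sub_eq_iff_eq_add.mp hc] at hg
      rw [e1]
      linear_combination -hg
  obtain ⟨ρ, h⟩ := h1
  rw [pow_mul, h]
  induction u with
  | zero => exact ⟨0, by simp⟩
  | succ u ih =>
    obtain ⟨σ, h⟩ := ih
    refine ⟨σ + ρ + p ^ v * (u * κ + p * σ) * (κ + p * ρ), ?_⟩
    rw [pow_succ, h]
    push_cast
    ring

/-- The quartic order `ℤ[√d][√(D₀ + D₁√d)]`. -/
abbrev QuarticOrder (d D₀ D₁ : ℤ) : Type :=
  QuadraticAlgebra (QuadraticAlgebra ℤ d 0) ⟨D₀, D₁⟩ 0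

namespace QuarticOrder

variable {d D₀ D₁ : ℤ}

/-- The image of an element of `ℤ[√d]` under a homomorphism-like real evaluation at `e`. -/
def toRealBase (e : ℝ) (x : QuadraticAlgebra ℤ d 0) : ℝ := x.re + x.im * e

/-- The real evaluation with `√d ↦ e` and `√(D₀ + D₁√d) ↦ δ`. -/
def toReal (e δ : ℝ) (x : QuarticOrder d D₀ D₁) : ℝ := toRealBase e x.re + toRealBase e x.im * δ

lemma toReal_mul {e δ : ℝ} (he : e ^ 2 = d) (hδ : δ ^ 2 = D₀ + D₁ * e)
    (x y : QuarticOrder d D₀ D₁) : toReal e δ (x * y) = toReal e δ x * toReal e δ y := by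
  simp only [toReal, toRealBase, QuadraticAlgebra.re_mul, QuadraticAlgebra.im_mul,
    QuadraticAlgebra.re_add, QuadraticAlgebra.im_add, QuadraticAlgebra.re_zero,
    QuadraticAlgebra.im_zero]
  push_cast
  generalize (x.re.re : ℝ) = a
  generalize (x.re.im : ℝ) = b
  generalize (x.im.re : ℝ) = c
  generalize (x.im.im : ℝ) = f
  generalize (y.re.re : ℝ) = a'
  generalize (y.re.im : ℝ) = b'
  generalize (y.im.re : ℝ) = c'
  generalize (y.im.im : ℝ) = f'
  linear_combination (-(c + f * e) * (c' + f' * e)) * hδ +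
    (-(b * b') - f * f' * (D₀ + D₁ * e) - (c * f' + f * c') * D₁ - (b * f' + f * b') * δ) * he

/-- The relative conjugate. -/
def conj (x : QuarticOrder d D₀ D₁) : QuarticOrder d D₀ D₁ := ⟨x.re, -x.im⟩

/-- Elements of relative norm one. -/
def NormOne (x : QuarticOrder d D₀ D₁) : Prop := x * conj x = 1

lemma conj_mul (x y : QuarticOrder d D₀ D₁) : conj (x * y) = conj x * conj y := by
  ext <;> simp [conj] <;> ring

lemma conj_conj (x : QuarticOrder d D₀ D₁) : conj (conj x) = x := by
  ext <;> simp [conj]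

lemma normOne_iff {x : QuarticOrder d D₀ D₁} : NormOne x ↔
    x.re.re ^ 2 + d * x.re.im ^ 2 - D₀ * (x.im.re ^ 2 + d * x.im.im ^ 2)
      - d * D₁ * (2 * x.im.re * x.im.im) = 1 ∧
    2 * x.re.re * x.re.im - D₀ * (2 * x.im.re * x.im.im)
      - D₁ * (x.im.re ^ 2 + d * x.im.im ^ 2) = 0 := by
  simp only [NormOne, conj, QuadraticAlgebra.ext_iff, QuadraticAlgebra.re_mul,
    QuadraticAlgebra.im_mul, QuadraticAlgebra.re_add, QuadraticAlgebra.im_add,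
    QuadraticAlgebra.re_neg, QuadraticAlgebra.im_neg, QuadraticAlgebra.re_one,
    QuadraticAlgebra.im_one, QuadraticAlgebra.re_zero, QuadraticAlgebra.im_zero]
  constructor
  · rintro ⟨⟨h1, h2⟩, -⟩
    exact ⟨by linear_combination h1, by linear_combination h2⟩
  · rintro ⟨h1, h2⟩
    exact ⟨⟨by linear_combination h1, by linear_combination h2⟩, by ring, by ring⟩

lemma NormOne.conj {x : QuarticOrder d D₀ D₁} (h : NormOne x) : NormOne (conj x) := by
  rw [NormOne, conj_conj, mul_comm]; exact h

lemma NormOne.mul {x y : QuarticOrder d D₀ D₁} (hx : NormOne x) (hy : NormOne y) :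
    NormOne (x * y) := by
  rw [NormOne] at *
  rw [conj_mul, mul_mul_mul_comm, hx, hy, one_mul]

/-- If `1` is the only element of relative norm one of real size in `[1/M, M)`, then the elements of
relative norm one and real size at least `1/M` are the powers of `τ`. -/
lemma eq_pow_of_normOne {e δ M : ℝ} (he : e ^ 2 = d) (hδ : δ ^ 2 = D₀ + D₁ * e)
    (hM : 0 < M) {τ : QuarticOrder d D₀ D₁} (hτ : NormOne τ) (hτ0 : 1 < toReal e δ τ)
    (hτM : toReal e δ τ ≤ M ^ 2)
    (hone : ∀ x : QuarticOrder d D₀ D₁, NormOne x → 1 / M ≤ toReal e δ x → toReal e δ x < M →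
      x = 1) {x : QuarticOrder d D₀ D₁} (hx : NormOne x) (hxM : 1 / M ≤ toReal e δ x) :
    ∃ n : ℕ, x = τ ^ n := by
  obtain ⟨n, hn⟩ := pow_unbounded_of_one_lt (toReal e δ x / M) hτ0
  rw [div_lt_iff₀ hM] at hn
  induction n generalizing x with
  | zero => exact ⟨0, by rw [pow_zero]; exact hone x hx hxM (by simpa using hn)⟩
  | succ n ih =>
    by_cases hlt : toReal e δ x < M
    · exact ⟨0, by rw [pow_zero]; exact hone x hx hxM hlt⟩
    · push Not at hlt
      have hinv : toReal e δ (x * QuarticOrder.conj τ) * toReal e δ τ = toReal e δ x := by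
        rw [← toReal_mul he hδ, mul_assoc, mul_comm (QuarticOrder.conj τ), hτ, mul_one]
      have hpos : 0 < toReal e δ τ := by linarith
      obtain ⟨k, hk⟩ := ih (hx.mul hτ.conj) (by
        rw [← mul_le_mul_iff_of_pos_right hpos, hinv]
        refine le_trans ?_ hlt
        rw [div_mul_eq_mul_div, one_mul, div_le_iff₀ hM]
        nlinarith) (by
        rw [← mul_lt_mul_iff_of_pos_right hpos, hinv]
        calc _ < _ := hn
          _ = _ := by ring)
      refine ⟨k + 1, ?_⟩
      rw [pow_succ, ← hk, mul_assoc, mul_comm (QuarticOrder.conj τ), hτ, mul_one]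

/-- The coefficient of `√d` in `(a + (4 + √d) b) b'`, where `x = a + b√D` and `b'` is the conjugate
of `b`, twisted by a sign `σ` on `b`. -/
def crossCoeff (σ : ℤ) (x : QuarticOrder d D₀ D₁) : ℤ :=
  σ * (x.im.re * x.re.im - x.im.im * x.re.re) + x.im.re ^ 2 - d * x.im.im ^ 2

lemma crossCoeff_conj (x : QuarticOrder d D₀ D₁) : crossCoeff 1 (conj x) = crossCoeff (-1) x := by
  simp [crossCoeff, conj]
  ring

lemma crossCoeff_add_three_mul (σ : ℤ) (x y : QuarticOrder d D₀ D₁) :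
    (3 : ℤ) ∣ crossCoeff σ (x + 3 * y) - crossCoeff σ x := by
  have h3 : (3 * y : QuarticOrder d D₀ D₁) = y + y + y := by ring
  refine ⟨σ * (x.im.re * y.re.im + y.im.re * x.re.im + 3 * y.im.re * y.re.im
    - x.im.im * y.re.re - y.im.im * x.re.re - 3 * y.im.im * y.re.re)
    + 2 * x.im.re * y.im.re + 3 * y.im.re ^ 2 - d * (2 * x.im.im * y.im.im + 3 * y.im.im ^ 2), ?_⟩
  rw [h3]
  simp only [crossCoeff, QuadraticAlgebra.re_add, QuadraticAlgebra.im_add]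
  ring

/-- A three-adic argument: the only power of `τ` with vanishing `crossCoeff` is the trivial one. -/
lemma eq_zero_of_crossCoeff_pow_eq_zero {τ κ : QuarticOrder d D₀ D₁} {σ : ℤ} (hσ : σ ^ 2 = 1)
    (hκ : τ ^ 3 = 1 + 3 * κ) (hκ3 : ¬ (3 : ℤ) ∣ κ.im.im) (h1 : ¬ (3 : ℤ) ∣ crossCoeff σ τ)
    (h2 : ¬ (3 : ℤ) ∣ crossCoeff σ (τ ^ 2)) {n : ℕ} (hn : crossCoeff σ (τ ^ n) = 0) : n = 0 := by
  by_contra hn0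
  have hmod : ∀ r : ℕ, n % 3 = r → (3 : ℤ) ∣ crossCoeff σ (τ ^ r) := by
    intro r hr
    obtain ⟨ρ, hρ⟩ := exists_one_add_mul_pow (p := 3) (by decide) κ 0 (n / 3)
    simp only [Nat.cast_ofNat] at hρ
    have : τ ^ n = τ ^ r + 3 * (τ ^ r * (↑(n / 3) * κ + 3 * ρ)) := by
      rw [← Nat.div_add_mod n 3, hr, pow_add, pow_mul, hκ]
      rw [pow_zero, one_mul] at hρ
      have e1 : (3 * (n / 3) + r) / 3 = n / 3 := by omega
      rw [hρ, e1]
      ring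
    have h3 := crossCoeff_add_three_mul σ (τ ^ r) (τ ^ r * (↑(n / 3) * κ + 3 * ρ))
    rw [← this, hn] at h3
    simpa using h3
  have hr : n % 3 = 0 := by
    have : n % 3 < 3 := Nat.mod_lt _ (by norm_num)
    interval_cases hc : n % 3
    · rfl
    · exact absurd (by simpa using hmod 1 rfl) h1
    · exact absurd (hmod 2 rfl) h2
  obtain ⟨m, rfl⟩ := Nat.dvd_of_mod_eq_zero hr
  obtain ⟨v, u, hu, rfl⟩ := Nat.exists_eq_pow_mul_and_not_dvd (n := m) (by omega) 3 (by norm_num)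
  obtain ⟨ρ, hρ⟩ := exists_one_add_mul_pow (p := 3) (by decide) κ v u
  simp only [Nat.cast_ofNat] at hρ
  rw [pow_mul, hκ, hρ] at hn
  have hx : (1 + 3 ^ (v + 1) * (↑u * κ) + 3 ^ (v + 2) * ρ : QuarticOrder d D₀ D₁)
      = 1 + ((3 ^ (v + 1) : ℤ)) • ((u : ℤ) • κ + (3 : ℤ) • ρ) := by
    simp only [zsmul_eq_mul]
    push_cast
    ring
  rw [hx] at hn
  simp only [crossCoeff, QuadraticAlgebra.re_add, QuadraticAlgebra.im_add,
    QuadraticAlgebra.re_smul, QuadraticAlgebra.im_smul, QuadraticAlgebra.re_one,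
    QuadraticAlgebra.im_one, QuadraticAlgebra.re_zero, QuadraticAlgebra.im_zero,
    smul_eq_mul] at hn
  set P := (u : ℤ) * κ.re.re + 3 * ρ.re.re
  set Q := (u : ℤ) * κ.re.im + 3 * ρ.re.im
  set T := (u : ℤ) * κ.im.re + 3 * ρ.im.re
  have h0 : (3 : ℤ) ^ (v + 1) * (σ * (T * (3 * 3 ^ v) * Q - ((u : ℤ) * κ.im.im + 3 * ρ.im.im) *
      (1 + 3 * 3 ^ v * P)) + 3 * 3 ^ v * T ^ 2 -
      d * (3 * 3 ^ v) * ((u : ℤ) * κ.im.im + 3 * ρ.im.im) ^ 2) = 0 := by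
    linear_combination hn
  have h0 := (mul_eq_zero.mp h0).resolve_left (by positivity)
  have hd : (3 : ℤ) ∣ u * κ.im.im := by
    refine ⟨σ * (σ * (T * 3 ^ v * Q - ρ.im.im - ((u : ℤ) * κ.im.im + 3 * ρ.im.im) * 3 ^ v * P)
      + 3 ^ v * T ^ 2 - d * 3 ^ v * ((u : ℤ) * κ.im.im + 3 * ρ.im.im) ^ 2), ?_⟩
    linear_combination -σ * h0 - u * κ.im.im * hσ
  rcases (Int.prime_three.dvd_mul.mp hd) with h | h
  · exact hu (by exact_mod_cast h)
  · exact hκ3 h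

lemma NormOne.neg {x : QuarticOrder d D₀ D₁} (h : NormOne x) : NormOne (-x) := by
  rw [normOne_iff] at *
  simpa using h

lemma toReal_neg (e δ : ℝ) (x : QuarticOrder d D₀ D₁) : toReal e δ (-x) = -toReal e δ x := by
  simp [toReal, toRealBase]
  ring

lemma toReal_one (e δ : ℝ) : toReal e δ (1 : QuarticOrder d D₀ D₁) = 1 := by
  simp [toReal, toRealBase, QuadraticAlgebra.re_one, QuadraticAlgebra.im_one]

/-- Under the hypotheses of `eq_pow_of_normOne` and the three-adic conditions, an element of
relative norm one with vanishing `crossCoeff` lies in the base ring. -/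
lemma im_eq_zero_of_crossCoeff_eq_zero {e δ M : ℝ} (he : e ^ 2 = d) (hδ : δ ^ 2 = D₀ + D₁ * e)
    (hM : 1 ≤ M) {τ κ : QuarticOrder d D₀ D₁} (hτ : NormOne τ) (hτ0 : 1 < toReal e δ τ)
    (hτM : toReal e δ τ ≤ M ^ 2)
    (hone : ∀ x : QuarticOrder d D₀ D₁, NormOne x → 1 / M ≤ toReal e δ x → toReal e δ x < M →
      x = 1)
    (hκ : τ ^ 3 = 1 + 3 * κ) (hκ3 : ¬ (3 : ℤ) ∣ κ.im.im)
    (h1 : ∀ σ : ℤ, σ ^ 2 = 1 → ¬ (3 : ℤ) ∣ crossCoeff σ τ)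
    (h2 : ∀ σ : ℤ, σ ^ 2 = 1 → ¬ (3 : ℤ) ∣ crossCoeff σ (τ ^ 2))
    {x : QuarticOrder d D₀ D₁} (hx : NormOne x) (hcr : crossCoeff 1 x = 0) : x.im = 0 := by
  have hM0 : 0 < M := by linarith
  wlog hpos : 0 ≤ toReal e δ x generalizing x
  · have := this hx.neg (by simpa [crossCoeff] using hcr) (by rw [toReal_neg]; linarith)
    simpa using this
  have hinv : toReal e δ x * toReal e δ (QuarticOrder.conj x) = 1 := by
    rw [← toReal_mul he hδ, hx, toReal_one]
  by_cases hge : 1 / M ≤ toReal e δ x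
  · obtain ⟨n, rfl⟩ := eq_pow_of_normOne he hδ hM0 hτ hτ0 hτM hone hx hge
    rw [eq_zero_of_crossCoeff_pow_eq_zero (by norm_num) hκ hκ3 (h1 1 (by norm_num))
      (h2 1 (by norm_num)) hcr, pow_zero, QuadraticAlgebra.im_one]
  · push Not at hge
    rw [lt_div_iff₀ hM0] at hge
    have hge' : 1 / M ≤ toReal e δ (QuarticOrder.conj x) := by
      rw [div_le_iff₀ hM0]
      by_contra hlt
      push Not at hlt
      nlinarith
    obtain ⟨n, hn⟩ := eq_pow_of_normOne he hδ hM0 hτ hτ0 hτM hone hx.conj hge'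
    have hn0 : n = 0 := by
      refine eq_zero_of_crossCoeff_pow_eq_zero (σ := -1) (by norm_num) hκ hκ3
        (h1 (-1) (by norm_num))
        (h2 (-1) (by norm_num)) ?_
      rw [← hn, ← crossCoeff_conj, conj_conj, hcr]
    have := congrArg QuadraticAlgebra.im hn
    rw [hn0, pow_zero, QuadraticAlgebra.im_one] at this
    simpa [QuarticOrder.conj] using this

/-- Size constraints on an element of relative norm one of moderate real size. -/
lemma bounds_of_normOne {D : ℤ} {e δ M : ℝ} (he : e ^ 2 = d) (hδ : δ ^ 2 = D + 8 * e)
    (hM : 1 ≤ M) {x : QuarticOrder d D 8} (hx : NormOne x)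
    (h1 : 1 / M ≤ toReal e δ x) (h2 : toReal e δ x < M) :
    |(x.im.re + x.im.im * e) * δ| < M / 2 ∧ (8 * e - D) * (x.im.re - x.im.im * e) ^ 2 ≤ 1 := by
  obtain ⟨⟨p, q⟩, ⟨t, w⟩⟩ := x
  rw [normOne_iff] at hx
  simp only [toReal, toRealBase] at h1 h2 hx ⊢
  obtain ⟨hy1, hy2⟩ := hx
  have hr1 : (p : ℝ) ^ 2 + d * q ^ 2 - D * (t ^ 2 + d * w ^ 2) - d * 8 * (2 * t * w) = 1 := by
    exact_mod_cast hy1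
  have hr2 : 2 * (p : ℝ) * q - D * (2 * t * w) - 8 * (t ^ 2 + d * w ^ 2) = 0 := by
    exact_mod_cast hy2
  have hprod : (p + q * e + (t + w * e) * δ) * (p + q * e - (t + w * e) * δ) = 1 := by
    linear_combination hr1 + e * hr2 + (q ^ 2 - (D + 8 * e) * w ^ 2 - 16 * t * w) * he
      - (t + w * e) ^ 2 * hδ
  have hconj : (p - q * e) ^ 2 + (8 * e - D) * (t - w * e) ^ 2 = 1 := by
    linear_combination hr1 - e * hr2 + (q ^ 2 - (D - 8 * e) * w ^ 2 - 16 * t * w) * he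
  have hM0 : 0 < M := by linarith
  have hinv : 0 < 1 / M := by positivity
  refine ⟨?_, by nlinarith [sq_nonneg (p - q * e)]⟩
  generalize p + q * e = a at *
  generalize (t + w * e) * δ = b at *
  have hab : 0 < a + b := by linarith
  have hab' : 0 < a - b := by
    by_contra h
    push Not at h
    nlinarith
  have h3 : a - b ≤ M := by
    rw [div_le_iff₀ hM0] at h1
    by_contra h
    push Not at h
    nlinarith
  rw [abs_lt]
  constructor <;> linarith

end QuarticOrder

lemma Int.three_dvd_mul_of_dvd_sq_add {p q : ℤ} (h : (3 : ℤ) ∣ p ^ 2 + 10 * q ^ 2) :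
    (3 : ℤ) ∣ p * q := by
  have hp : p % 3 = 0 ∨ p % 3 = 1 ∨ p % 3 = 2 := by omega
  have hq : q % 3 = 0 ∨ q % 3 = 1 ∨ q % 3 = 2 := by omega
  rw [Int.dvd_iff_emod_eq_zero] at *
  rcases hp with hp | hp | hp <;> rcases hq with hq | hq | hq <;>
    simp [pow_two, Int.add_emod, Int.mul_emod, hp, hq] at h ⊢

/-- An element of the base ring of relative norm one and positive real size is one. -/
lemma QuarticOrder.eq_one_of_im_eq_zero {d D₀ D₁ : ℤ} (hd : 2 ≤ d) {e δ : ℝ}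
    {x : QuarticOrder d D₀ D₁} (hx : NormOne x) (h0 : 0 < toReal e δ x)
    (hre : x.im.re = 0) (him : x.im.im = 0) : x = 1 := by
  obtain ⟨⟨p, q⟩, ⟨t, w⟩⟩ := x
  rw [normOne_iff] at hx
  simp only [toReal, toRealBase] at h0 hx hre him
  subst hre him
  norm_num at hx h0
  obtain ⟨hy1, hy2⟩ := hx
  have hpq : q = 0 := by
    rcases hy2 with rfl | rfl
    · by_contra hq
      have : 1 ≤ q ^ 2 := by have := sq_pos_of_ne_zero hq; omega
      nlinarith
    · rfl
  subst hpq
  norm_num at h0 hy1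
  rcases hy1 with rfl | rfl
  · rfl
  · norm_num at h0

open QuarticOrder in
lemma eq_one_of_small_normOne_six {e δ : ℝ} (he1 : 2.449 < e) (he2 : e < 2.4495) (hδ1 : 5.62 < δ)
    {x : QuarticOrder 6 12 8}
    (hc : (8 * e - 12) * (x.im.re - x.im.im * e) ^ 2 ≤ 1)
    (hb : |(x.im.re + x.im.im * e) * δ| < 31 / 2) (hx : NormOne x) (h0 : 0 < toReal e δ x) :
    x = 1 := by
  suffices h : x.im.re = 0 ∧ x.im.im = 0 from
    eq_one_of_im_eq_zero (by norm_num) hx h0 h.1 h.2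
  rw [normOne_iff] at hx
  clear h0
  generalize x.im.re = t at *
  generalize x.im.im = w at *
  generalize x.re.re = p at *
  generalize x.re.im = q at *
  obtain ⟨hy1, hy2⟩ := hx
  rw [abs_mul, abs_of_pos (by linarith : 0 < δ)] at hb
  have hb : |t + w * e| < 2.76 := by
    by_contra h
    push Not at h
    nlinarith
  have hc : |t - w * e| < 0.37 := by
    by_contra h
    push Not at h
    have := mul_le_mul h h (by norm_num) (abs_nonneg _)
    rw [abs_mul_abs_self] at this
    nlinarith
  rw [abs_lt] at hb hc
  have hw1 : (w : ℝ) < 1 := by nlinarith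
  have hw2 : (-1 : ℝ) < w := by nlinarith
  have hw1 : w < 1 := by exact_mod_cast hw1
  have hw2 : -1 < w := by exact_mod_cast hw2
  obtain rfl : w = 0 := by omega
  norm_num at hc
  have ht1 : t < 1 := by exact_mod_cast (show (t : ℝ) < 1 by linarith)
  have ht2 : -1 < t := by exact_mod_cast (show (-1 : ℝ) < t by linarith)
  exact ⟨by omega, rfl⟩

open QuarticOrder in
lemma im_eq_zero_of_normOne_six {x : QuarticOrder 6 12 8} (hx : NormOne x)
    (hcr : crossCoeff 1 x = 0) : x.im = 0 := by
  have hσ : ∀ σ : ℤ, σ ^ 2 = 1 → σ = 1 ∨ σ = -1 := fun σ h => by simpa using h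
  obtain ⟨e, he0, he⟩ : ∃ e : ℝ, 0 ≤ e ∧ e ^ 2 = 6 := ⟨√6, by positivity, by norm_num⟩
  have he1 : 2.449 < e := by nlinarith
  have he2 : e < 2.4495 := by nlinarith
  obtain ⟨δ, hδ0, hδ⟩ : ∃ δ : ℝ, 0 ≤ δ ∧ δ ^ 2 = 12 + 8 * e :=
    ⟨√(12 + 8 * e), by positivity, Real.sq_sqrt (by positivity)⟩
  have hδ1 : 5.62 < δ := by nlinarith
  have hδ2 : δ < 5.63 := by nlinarith
  refine im_eq_zero_of_crossCoeff_eq_zero (e := e) (δ := δ) (M := 31) (τ := ⟨⟨235, 96⟩, ⟨42, 17⟩⟩)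
    (κ := ⟨⟨69281838, 28284192⟩, ⟨12325482, 5031857⟩⟩)
    (by rw [he]; norm_num) (by rw [hδ]; norm_num) (by norm_num) ?_ ?_ ?_ ?_ ?_ ?_ ?_ ?_ hx hcr
  · rw [normOne_iff]; norm_num
  · simp only [toReal, toRealBase]; push_cast; nlinarith
  · simp only [toReal, toRealBase]; push_cast; nlinarith
  · intro y hy h1 h2
    obtain ⟨hb, hc⟩ := bounds_of_normOne (by rw [he]; norm_num) (by rw [hδ]; norm_num)
      (by norm_num) hy h1 h2
    refine eq_one_of_small_normOne_six he1 he2 hδ1 (by push_cast at hc; exact hc) hb hy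
      (lt_of_lt_of_le (by norm_num) h1)
  · decide
  · decide
  · intro σ h
    rcases hσ σ h with rfl | rfl <;> decide
  · intro σ h
    rcases hσ σ h with rfl | rfl <;> decide

open QuarticOrder in
lemma eq_one_of_small_normOne_ten {e δ : ℝ} (he1 : 3.1622 < e) (he2 : e < 3.1623) (hδ1 : 6.73 < δ)
    {x : QuarticOrder 10 20 8}
    (hc : (8 * e - 20) * (x.im.re - x.im.im * e) ^ 2 ≤ 1)
    (hb : |(x.im.re + x.im.im * e) * δ| < 304 / 2) (hx : NormOne x) (h0 : 0 < toReal e δ x) :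
    x = 1 := by
  suffices h : x.im.re = 0 ∧ x.im.im = 0 from
    eq_one_of_im_eq_zero (by norm_num) hx h0 h.1 h.2
  rw [normOne_iff] at hx
  clear h0
  generalize x.im.re = t at *
  generalize x.im.im = w at *
  generalize x.re.re = p at *
  generalize x.re.im = q at *
  obtain ⟨hy1, hy2⟩ := hx
  rw [abs_mul, abs_of_pos (by linarith : 0 < δ)] at hb
  have hb : |t + w * e| < 22.6 := by
    by_contra h
    push Not at h
    nlinarith
  have hc : |t - w * e| < 0.435 := by
    by_contra h
    push Not at h
    have := mul_le_mul h h (by norm_num) (abs_nonneg _)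
    rw [abs_mul_abs_self] at this
    nlinarith
  rw [abs_lt] at hb hc
  have hw1 : (w : ℝ) < 4 := by nlinarith
  have hw2 : (-4 : ℝ) < w := by nlinarith
  have hw1 : w < 4 := by exact_mod_cast hw1
  have hw2 : -4 < w := by exact_mod_cast hw2
  have ht1 : (t : ℝ) < w * e + 0.435 := by linarith
  have ht2 : w * e - 0.435 < (t : ℝ) := by linarith
  have hcases : (t = 0 ∧ w = 0) ∨ (t = 3 ∧ w = 1) ∨ (t = 6 ∧ w = 2) ∨ (t = -3 ∧ w = -1) ∨
      (t = -6 ∧ w = -2) := by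
    have key : ∀ k : ℤ, (k - 1 : ℝ) < w * e - 0.435 → w * e + 0.435 < (k + 1 : ℝ) → t = k := by
      intro k hk1 hk2
      have h5 : t < k + 1 := by exact_mod_cast (show (t : ℝ) < k + 1 by linarith)
      have h6 : k - 1 < t := by exact_mod_cast (show (k - 1 : ℝ) < t by linarith)
      omega
    have key' : ∀ k : ℤ, (k : ℝ) < w * e - 0.435 → w * e + 0.435 < (k + 1 : ℝ) → False := by
      intro k hk1 hk2
      have h5 : t < k + 1 := by exact_mod_cast (show (t : ℝ) < k + 1 by linarith)
      have h6 : k < t := by exact_mod_cast (show (k : ℝ) < t by linarith)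
      omega
    clear ht1 ht2 hb hc hy1 hy2
    interval_cases w
    · exact (key' (-10) (by push_cast; linarith) (by push_cast; linarith)).elim
    · simpa using key (-6) (by push_cast; linarith) (by push_cast; linarith)
    · simpa using key (-3) (by push_cast; linarith) (by push_cast; linarith)
    · simpa using key 0 (by push_cast; linarith) (by push_cast; linarith)
    · simpa using key 3 (by push_cast; linarith) (by push_cast; linarith)
    · simpa using key 6 (by push_cast; linarith) (by push_cast; linarith)
    · exact (key' 9 (by push_cast; linarith) (by push_cast; linarith)).elim
  have hdvd := Int.three_dvd_mul_of_dvd_sq_add (p := p) (q := q)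
  clear ht1 ht2 hb hc
  rcases hcases with ⟨rfl, rfl⟩ | ⟨rfl, rfl⟩ | ⟨rfl, rfl⟩ | ⟨rfl, rfl⟩ | ⟨rfl, rfl⟩
  · exact ⟨rfl, rfl⟩
  · have := hdvd ⟨287, by linarith⟩
    rw [(by linarith : p * q = 136)] at this
    norm_num at this
  · have := hdvd ⟨1147, by linarith⟩
    rw [(by linarith : p * q = 544)] at this
    norm_num at this
  · have := hdvd ⟨287, by linarith⟩
    rw [(by linarith : p * q = 136)] at this
    norm_num at this
  · have := hdvd ⟨1147, by linarith⟩
    rw [(by linarith : p * q = 544)] at this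
    norm_num at this

open QuarticOrder in
lemma im_eq_zero_of_normOne_ten {x : QuarticOrder 10 20 8} (hx : NormOne x)
    (hcr : crossCoeff 1 x = 0) : x.im = 0 := by
  have hσ : ∀ σ : ℤ, σ ^ 2 = 1 → σ = 1 ∨ σ = -1 := fun σ h => by simpa using h
  obtain ⟨e, he0, he⟩ : ∃ e : ℝ, 0 ≤ e ∧ e ^ 2 = 10 := ⟨√10, by positivity, by norm_num⟩
  have he1 : 3.1622 < e := by nlinarith
  have he2 : e < 3.1623 := by nlinarith
  obtain ⟨δ, hδ0, hδ⟩ : ∃ δ : ℝ, 0 ≤ δ ∧ δ ^ 2 = 20 + 8 * e :=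
    ⟨√(20 + 8 * e), by positivity, Real.sq_sqrt (by positivity)⟩
  have hδ1 : 6.73 < δ := by nlinarith
  have hδ2 : δ < 6.731 := by nlinarith
  refine im_eq_zero_of_crossCoeff_eq_zero (e := e) (δ := δ) (M := 304)
    (τ := ⟨⟨23071, 7296⟩, ⟨3428, 1084⟩⟩)
    (κ := ⟨⟨65497631402250, 20712169657728⟩, ⟨9731617268068, 3077407588412⟩⟩)
    (by rw [he]; norm_num) (by rw [hδ]; norm_num) (by norm_num) ?_ ?_ ?_ ?_ ?_ ?_ ?_ ?_ hx hcr
  · rw [normOne_iff]; norm_num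
  · simp only [toReal, toRealBase]; push_cast; nlinarith
  · simp only [toReal, toRealBase]; push_cast; nlinarith
  · intro y hy h1 h2
    obtain ⟨hb, hc⟩ := bounds_of_normOne (by rw [he]; norm_num) (by rw [hδ]; norm_num)
      (by norm_num) hy h1 h2
    refine eq_one_of_small_normOne_ten he1 he2 hδ1 (by push_cast at hc; exact hc) hb hy
      (lt_of_lt_of_le (by norm_num) h1)
  · decide
  · decide
  · intro σ h
    rcases hσ σ h with rfl | rfl <;> decide
  · intro σ h
    rcases hσ σ h with rfl | rfl <;> decide

lemma Nat.exists_eq_mul_sq_of_coprime {M N D w : ℕ} (hc : M.Coprime N) (h : M * N = D * w ^ 2)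
    (hD : 0 < D) : ∃ a b r s, a * b = D ∧ M = a * r ^ 2 ∧ N = b * s ^ 2 ∧ w = r * s := by
  have hab : D.gcd M * D.gcd N = D := by
    rw [← hc.gcd_mul, h, Nat.gcd_eq_left (Dvd.intro _ rfl)]
  obtain ⟨M', hM⟩ := Nat.gcd_dvd_right D M
  obtain ⟨N', hN⟩ := Nat.gcd_dvd_right D N
  have hMN : M' * N' = w ^ 2 := by
    refine Nat.eq_of_mul_eq_mul_left hD ?_
    calc D * (M' * N') = (D.gcd M * D.gcd N) * (M' * N') := by rw [hab]
      _ = (D.gcd M * M') * (D.gcd N * N') := by ring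
      _ = D * w ^ 2 := by rw [← hM, ← hN, h]
  have hc' : M'.Coprime N' := by
    refine Nat.Coprime.of_dvd ?_ ?_ hc
    · rw [hM]; exact Dvd.intro_left _ rfl
    · rw [hN]; exact Dvd.intro_left _ rfl
  obtain ⟨r, hr⟩ := exists_eq_pow_of_mul_eq_pow (Nat.isUnit_iff.mpr hc') hMN
  obtain ⟨s, hs⟩ := exists_eq_pow_of_mul_eq_pow (Nat.isUnit_iff.mpr hc'.symm)
    ((mul_comm _ _).trans hMN)
  refine ⟨D.gcd M, D.gcd N, r, s, hab, by rw [← hr, ← hM], by rw [← hs, ← hN], ?_⟩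
  rw [hr, hs, ← mul_pow] at hMN
  exact (Nat.pow_left_injective (n := 2) (by norm_num) hMN).symm

lemma Nat.eq_of_mul_eq_six {a b : ℕ} (h : a * b = 6) :
    (a = 1 ∧ b = 6) ∨ (a = 6 ∧ b = 1) ∨ (a = 2 ∧ b = 3) ∨ (a = 3 ∧ b = 2) := by
  have ha : a ≤ 6 := Nat.le_of_dvd (by norm_num) (Dvd.intro _ h)
  interval_cases a <;> omega

lemma Nat.eq_of_mul_eq_ten {a b : ℕ} (h : a * b = 10) :
    (a = 1 ∧ b = 10) ∨ (a = 10 ∧ b = 1) ∨ (a = 2 ∧ b = 5) ∨ (a = 5 ∧ b = 2) := by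
  have ha : a ≤ 10 := Nat.le_of_dvd (by norm_num) (Dvd.intro _ h)
  interval_cases a <;> omega

/-- Splitting of a Pell solution `f ^ 2 - 4 D k ^ 2 = 1`. -/
lemma exists_pell_split {f k : ℤ} {D : ℕ} (hD : 0 < D) (h : f ^ 2 = 1 + 4 * D * k ^ 2) :
    ∃ (a b : ℕ) (V U : ℤ), a * b = D ∧ |f| = a * V ^ 2 + b * U ^ 2 ∧ a * V ^ 2 - b * U ^ 2 = 1 ∧
      k = V * U := by
  have hodd : |f| % 2 = 1 := by
    rw [← sq_abs] at h
    rcases Int.emod_two_eq_zero_or_one |f| with h0 | h0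
    · exfalso
      obtain ⟨g, hg⟩ := Int.dvd_of_emod_eq_zero h0
      rw [hg] at h
      have : 2 * (2 * g ^ 2 - 2 * (D * k ^ 2)) = 1 := by linear_combination h
      omega
    · exact h0
  obtain ⟨n, hn⟩ : ∃ n : ℕ, |f| = 2 * n + 1 := by
    refine ⟨(|f| / 2).toNat, ?_⟩
    have := abs_nonneg f
    omega
  have hmul : (n + 1) * n = D * k.natAbs ^ 2 := by
    have : ((n : ℤ) + 1) * n = D * (k.natAbs : ℤ) ^ 2 := by
      rw [Int.natCast_natAbs, sq_abs]
      rw [← sq_abs, hn] at h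
      nlinarith
    exact_mod_cast this
  obtain ⟨a, b, r, s, hab, hr, hs, hk⟩ :=
    Nat.exists_eq_mul_sq_of_coprime (by simp) hmul hD
  have hr' : (n : ℤ) + 1 = a * r ^ 2 := by exact_mod_cast hr
  have hs' : (n : ℤ) = b * s ^ 2 := by exact_mod_cast hs
  rcases Int.natAbs_eq k with hk' | hk'
  · exact ⟨a, b, r, s, hab, by rw [hn]; linarith, by linarith, by rw [hk', hk]; push_cast; ring⟩
  · exact ⟨a, b, r, -s, hab, by rw [hn, neg_sq]; linarith, by rw [neg_sq]; linarith,
      by rw [hk', hk]; push_cast; ring⟩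

lemma no_solution_mod_three {x y : ℤ} (h : x ^ 2 + 1 = 3 * y) : False := by
  have : x % 3 = 0 ∨ x % 3 = 1 ∨ x % 3 = 2 := by omega
  have h2 : (x ^ 2 + 1) % 3 = 0 := by omega
  rcases this with hx | hx | hx <;> simp [pow_two, Int.add_emod, Int.mul_emod, hx] at h2

lemma no_solution_mod_five {x y : ℤ} (h : 2 * x ^ 2 + 1 = 5 * y ∨ 2 * x ^ 2 - 1 = 5 * y) :
    False := by
  have : x % 5 = 0 ∨ x % 5 = 1 ∨ x % 5 = 2 ∨ x % 5 = 3 ∨ x % 5 = 4 := by omega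
  have h2 : (2 * x ^ 2 + 1) % 5 = 0 ∨ (2 * x ^ 2 - 1) % 5 = 0 := by omega
  rcases this with hx | hx | hx | hx | hx <;>
    simp [pow_two, Int.add_emod, Int.sub_emod, Int.mul_emod, hx] at h2

/-- Pell splitting for `D = 6`. -/
lemma exists_pell_split_six {f k : ℤ} (h : f ^ 2 = 1 + 24 * k ^ 2) :
    ∃ V U : ℤ, k = V * U ∧ ((|f| = V ^ 2 + 6 * U ^ 2 ∧ V ^ 2 - 6 * U ^ 2 = 1) ∨
      (|f| = 3 * V ^ 2 + 2 * U ^ 2 ∧ 3 * V ^ 2 - 2 * U ^ 2 = 1)) := by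
  obtain ⟨a, b, V, U, hab, hf, hV, hk⟩ := exists_pell_split (D := 6) (by norm_num)
    (h.trans (by push_cast; ring))
  refine ⟨V, U, hk, ?_⟩
  rcases Nat.eq_of_mul_eq_six hab with ⟨rfl, rfl⟩ | ⟨rfl, rfl⟩ | ⟨rfl, rfl⟩ | ⟨rfl, rfl⟩ <;>
    push_cast at hf hV
  · left; constructor <;> linarith
  · exact (no_solution_mod_three (x := U) (y := 2 * V ^ 2) (by linarith)).elim
  · exact (no_solution_mod_three (x := V) (y := V ^ 2 - U ^ 2) (by linarith)).elim
  · right; constructor <;> linarith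

/-- Pell splitting for `D = 10`. -/
lemma exists_pell_split_ten {f k : ℤ} (h : f ^ 2 = 1 + 40 * k ^ 2) :
    ∃ V U : ℤ, k = V * U ∧ |f| = V ^ 2 + 10 * U ^ 2 ∧
      (V ^ 2 - 10 * U ^ 2 = 1 ∨ V ^ 2 - 10 * U ^ 2 = -1) := by
  obtain ⟨a, b, V, U, hab, hf, hV, hk⟩ := exists_pell_split (D := 10) (by norm_num)
    (h.trans (by push_cast; ring))
  rcases Nat.eq_of_mul_eq_ten hab with ⟨rfl, rfl⟩ | ⟨rfl, rfl⟩ | ⟨rfl, rfl⟩ | ⟨rfl, rfl⟩ <;>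
    push_cast at hf hV
  · exact ⟨V, U, hk, by linarith, by left; linarith⟩
  · exact ⟨U, V, by linarith, by linarith, by right; linarith⟩
  · exact (no_solution_mod_five (x := V) (y := U ^ 2) (by right; linarith)).elim
  · exact (no_solution_mod_five (x := U) (y := V ^ 2) (by left; linarith)).elim

lemma mod_eight_obstruction_six :
    ∀ x y r s : ZMod 8, 3 * x ^ 2 - 2 * y ^ 2 = 1 →
      r ^ 2 + 2 * s ^ 2 = 3 * x ^ 2 + 2 * y ^ 2 → False := by
  decide +kernel

open QuarticOrder in
lemma thue_six {r s : ℤ} (h : (r ^ 2 - 8 * (r * s) + 10 * s ^ 2) ^ 2 = 1 + 24 * (r * s) ^ 2) :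
    s = 0 := by
  have hpos : 0 ≤ r ^ 2 - 8 * (r * s) + 10 * s ^ 2 := by
    by_contra hneg
    push Not at hneg
    have h1 : 0 ≤ r ^ 2 - 8 * (r * s) + 10 * s ^ 2 + 2 * (r * s) := by
      nlinarith [sq_nonneg (r - 3 * s), sq_nonneg s]
    nlinarith
  obtain ⟨V, U, hrs, ⟨hf, hN⟩ | ⟨hf, hN⟩⟩ := exists_pell_split_six h
  · rw [abs_of_nonneg hpos] at hf
    have := im_eq_zero_of_normOne_six (x := ⟨⟨V * (r - 4 * s) - 6 * U * s,
      U * (r - 4 * s) - V * s⟩, ⟨V * s, U * s⟩⟩) (normOne_iff.mpr ⟨?_, ?_⟩) ?_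
    · rw [QuadraticAlgebra.ext_iff] at this
      obtain ⟨h1, h2⟩ := this
      simp at h1 h2
      rcases h1 with rfl | h1
      · rcases h2 with rfl | h2
        · norm_num at hN
        · exact h2
      · exact h1
    · simp only
      linear_combination (V ^ 2 + 6 * U ^ 2) * hf - 24 * V * U * hrs + (V ^ 2 - 6 * U ^ 2 + 1) * hN
    · simp only
      linear_combination -2 * (V ^ 2 + 6 * U ^ 2) * hrs + 2 * V * U * hf
    · simp only [crossCoeff]
      ring
  · exfalso
    rw [abs_of_nonneg hpos] at hf
    have h1 := congrArg (Int.cast : ℤ → ZMod 8) hf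
    have h2 := congrArg (Int.cast : ℤ → ZMod 8) hN
    push_cast at h1 h2
    refine mod_eight_obstruction_six V U r s h2 (Eq.trans ?_ h1)
    have h8 : (8 : ZMod 8) = 0 := by decide
    linear_combination (r * s - s ^ 2 : ZMod 8) * h8

open QuarticOrder in
lemma thue_ten {r s : ℤ} (h : (r ^ 2 - 8 * (r * s) + 6 * s ^ 2) ^ 2 = 1 + 40 * (r * s) ^ 2) :
    s = 0 := by
  have hpos : 0 ≤ r ^ 2 - 8 * (r * s) + 6 * s ^ 2 := by
    by_contra hneg
    push Not at hneg
    have h1 : 0 ≤ r ^ 2 - 8 * (r * s) + 6 * s ^ 2 + 4 * (r * s) := by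
      nlinarith [sq_nonneg (r - 2 * s), sq_nonneg s]
    nlinarith
  obtain ⟨V, U, hrs, hf, hN⟩ := exists_pell_split_ten h
  rw [abs_of_nonneg hpos] at hf
  have hN2 : (V ^ 2 - 10 * U ^ 2) ^ 2 = 1 := by
    rcases hN with hN | hN <;> rw [hN] <;> norm_num
  have := im_eq_zero_of_normOne_ten (x := ⟨⟨V * (r - 4 * s) - 10 * U * s,
    U * (r - 4 * s) - V * s⟩, ⟨V * s, U * s⟩⟩) (normOne_iff.mpr ⟨?_, ?_⟩) ?_
  · rw [QuadraticAlgebra.ext_iff] at this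
    obtain ⟨h1, h2⟩ := this
    simp at h1 h2
    rcases h1 with rfl | h1
    · rcases h2 with rfl | h2
      · norm_num at hN
      · exact h2
    · exact h1
  · simp only
    linear_combination (V ^ 2 + 10 * U ^ 2) * hf - 40 * V * U * hrs + hN2
  · simp only
    linear_combination -2 * (V ^ 2 + 10 * U ^ 2) * hrs + 2 * V * U * hf
  · simp only [crossCoeff]
    ring

/-- Second splitting: `A² = (V + 8u)² - 4 m u²` with `V² - 4 (16 - m) u² = 1`. -/
lemma exists_quadratic_form_of_sq {A V u : ℤ} {m : ℕ} (hm : 0 < m) (hA : A % 2 = 1) (hV : V % 2 = 1)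
    (h : A ^ 2 = (V + 8 * u) ^ 2 - 4 * m * u ^ 2)
    (hN : V ^ 2 - 4 * (16 - m) * u ^ 2 = 1) :
    ∃ (a b : ℕ) (r s : ℤ), a * b = m ∧ |u| = |r * s| ∧
      V ^ 2 = (a * r ^ 2 - 8 * (r * s) + b * s ^ 2) ^ 2 := by
  wlog hpos : 0 ≤ V + 8 * u generalizing V u
  · obtain ⟨a, b, r, s, hab, hu, hV'⟩ := this (V := -V) (u := -u) (by omega)
      (by rw [h]; ring) (by rw [← hN]; ring) (by linarith)
    exact ⟨a, b, r, s, hab, by rw [← hu, abs_neg], by rw [← hV', neg_sq]⟩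
  obtain ⟨M, hM⟩ : ∃ M, V + 8 * u - A = 2 * M := ⟨(V + 8 * u - A) / 2, by omega⟩
  obtain ⟨N, hN'⟩ : ∃ N, V + 8 * u + A = 2 * N := ⟨(V + 8 * u + A) / 2, by omega⟩
  have hMN : M * N = m * u ^ 2 := by
    have : 4 * (M * N) = 4 * (m * u ^ 2) := by
      calc 4 * (M * N) = (2 * M) * (2 * N) := by ring
        _ = 4 * (m * u ^ 2) := by rw [← hM, ← hN']; linear_combination -h
    linarith
  have hsum : M + N = V + 8 * u := by linarith
  have hMN0 : 0 ≤ M * N := by rw [hMN]; positivity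
  have hM0 : 0 ≤ M := by nlinarith
  have hN0 : 0 ≤ N := by nlinarith
  have hcop : IsCoprime M N := by
    refine ⟨M + N - 16 * u + 4 * N, M + N - 16 * u, ?_⟩
    have hV' : V = M + N - 8 * u := by linarith
    rw [hV'] at hN
    linear_combination hN + 4 * hMN
  lift M to ℕ using hM0
  lift N to ℕ using hN0
  have hMN' : M * N = m * u.natAbs ^ 2 := by
    have : (M : ℤ) * N = m * (u.natAbs : ℤ) ^ 2 := by rw [Int.natCast_natAbs, sq_abs, hMN]
    exact_mod_cast this
  obtain ⟨a, b, r, s, hab, hr, hs, hu⟩ := Nat.exists_eq_mul_sq_of_coprime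
    (Nat.isCoprime_iff_coprime.mp hcop) hMN' hm
  have hr' : (M : ℤ) = a * r ^ 2 := by exact_mod_cast hr
  have hs' : (N : ℤ) = b * s ^ 2 := by exact_mod_cast hs
  have hu' : |u| = r * s := by rw [← Int.natCast_natAbs, hu]; push_cast; ring
  have hV' : V = M + N - 8 * u := by linarith
  rcases abs_choice u with hc | hc
  · refine ⟨a, b, r, s, hab, by rw [← hu', abs_abs], ?_⟩
    rw [hV', hr', hs', ← hc, hu']; ring
  · refine ⟨a, b, r, -s, hab, by rw [mul_neg, abs_neg, ← hu', abs_abs], ?_⟩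
    rw [hV', hr', hs', ← neg_neg u, ← hc, hu']; ring

lemma odd_of_pow_four {a b A : ℤ} (hb : b % 2 = 1) {C : ℤ}
    (h : a * A ^ 4 + b = 8 * C ^ 2) : A % 2 = 1 := by
  rcases Int.emod_two_eq_zero_or_one A with h0 | h0
  · obtain ⟨g, rfl⟩ := Int.dvd_of_emod_eq_zero h0
    have : b = 2 * (4 * C ^ 2 - 8 * a * g ^ 4) := by linear_combination h
    omega
  · exact h0

lemma Int.even_of_mod_eight {V U c : ℤ} (hc : c % 4 = 2) (h : V ^ 2 - c * U ^ 2 = 1) :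
    V % 2 = 1 ∧ U % 2 = 0 := by
  have key : ∀ v w c : ZMod 8, (c = 2 ∨ c = 6) → v ^ 2 - c * w ^ 2 = 1 →
      4 * v = 4 ∧ 4 * w = 0 := by decide +kernel
  have h1 := congrArg (Int.cast : ℤ → ZMod 8) h
  push_cast at h1
  have hc' : (c : ZMod 8) = 2 ∨ (c : ZMod 8) = 6 := by
    have : c % 8 = 2 ∨ c % 8 = 6 := by omega
    rcases this with h | h
    · left; exact_mod_cast (ZMod.intCast_eq_intCast_iff c 2 8).mpr h
    · right; exact_mod_cast (ZMod.intCast_eq_intCast_iff c 6 8).mpr h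
  obtain ⟨h2, h3⟩ := key V U c hc' h1
  constructor
  · have := (ZMod.intCast_eq_intCast_iff (4 * V) 4 8).mp (by push_cast; exact h2)
    have : (4 * V) % 8 = 4 % 8 := this
    omega
  · have := (ZMod.intCast_eq_intCast_iff (4 * U) 0 8).mp (by push_cast; exact h3)
    have : (4 * U) % 8 = 0 % 8 := this
    omega

lemma Int.sq_emod_eight_of_odd {A : ℤ} (h : A % 2 = 1) : A ^ 2 % 8 = 1 := by
  have : A % 8 = 1 ∨ A % 8 = 3 ∨ A % 8 = 5 ∨ A % 8 = 7 := by omega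
  rcases this with h | h | h | h <;> simp [pow_two, Int.mul_emod, h]

lemma sq_eq_one_of_three_mul_pow_four_add {A C : ℤ} (h : 3 * A ^ 4 + 5 = 8 * C ^ 2) :
    A ^ 2 = 1 := by
  have hA := odd_of_pow_four (by norm_num) h
  have hA8 := Int.sq_emod_eight_of_odd hA
  wlog hC : (5 : ℤ) ∣ A ^ 2 - C generalizing C
  · refine this (C := -C) (by rw [neg_sq, h]) ?_
    have hd : (5 : ℤ) ∣ (A ^ 2 - C) * (A ^ 2 + C) := ⟨3 * C ^ 2 - 2 - A ^ 4, by
      linear_combination 2 * h⟩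
    rw [sub_neg_eq_add]
    exact ((Nat.prime_iff_prime_int.mp Nat.prime_five).dvd_mul.mp hd).resolve_left hC
  obtain ⟨k, hk⟩ := hC
  have hf : (A ^ 2 - 8 * k) ^ 2 = 1 + 24 * k ^ 2 := by
    obtain rfl : C = A ^ 2 - 5 * k := by linarith
    linarith
  obtain ⟨V, U, rfl, ⟨hf', hN⟩ | ⟨hf', hN⟩⟩ := exists_pell_split_six hf
  · obtain ⟨hV, hU⟩ := Int.even_of_mod_eight (by norm_num) hN
    obtain ⟨u, rfl⟩ := Int.dvd_of_emod_eq_zero hU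
    have hV8 := Int.sq_emod_eight_of_odd hV
    have hfpos : A ^ 2 - 8 * (V * (2 * u)) = V ^ 2 + 6 * (2 * u) ^ 2 := by
      rcases abs_choice (A ^ 2 - 8 * (V * (2 * u))) with hc | hc
      · rw [← hc, hf']
      · rw [hf'] at hc
        have : 6 * (2 * u) ^ 2 = V ^ 2 - 1 := by linarith
        omega
    obtain ⟨a, b, r, s, hab, hu, hV2⟩ := exists_quadratic_form_of_sq (A := A) (V := V) (u := u)
      (m := 10) (by norm_num) hA hV (by push_cast; linear_combination hfpos)
      (by push_cast; linear_combination hN)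
    have hu2 : u ^ 2 = (r * s) ^ 2 := by rw [← sq_abs, hu, sq_abs]
    have hval : (a * r ^ 2 - 8 * (r * s) + b * s ^ 2) ^ 2 = 1 + 24 * (r * s) ^ 2 := by
      rw [← hV2, ← hu2]; linear_combination hN
    have hu0 : u ^ 2 = 0 := by
      have key : ∀ r s : ZMod 16, (2 * r ^ 2 - 8 * (r * s) + 5 * s ^ 2) ^ 2 = 1 + 24 * (r * s) ^ 2 →
        False := by decide +kernel
      rw [hu2]
      rcases Nat.eq_of_mul_eq_ten hab with ⟨rfl, rfl⟩ | ⟨rfl, rfl⟩ | ⟨rfl, rfl⟩ | ⟨rfl, rfl⟩ <;>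
        push_cast at hval
      · rw [thue_six (r := r) (s := s) (by rw [← hval]; ring)]; ring
      · rw [thue_six (r := s) (s := r) (by rw [mul_comm s r, ← hval]; ring)]; ring
      · have h1 := congrArg (Int.cast : ℤ → ZMod 16) hval
        push_cast at h1
        exact (key r s h1).elim
      · have h1 := congrArg (Int.cast : ℤ → ZMod 16) hval
        push_cast at h1
        exact (key s r (by rw [mul_comm (s : ZMod 16) r, ← h1]; ring)).elim
    have hu0 : u = 0 := by simpa using hu0
    subst hu0
    linear_combination hfpos + hN
  · exfalso
    have key : ∀ v w : ZMod 8, 3 * v ^ 2 - 2 * w ^ 2 = 1 → 3 * v ^ 2 + 2 * w ^ 2 = 5 := by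
      decide +kernel
    have h1 := congrArg (Int.cast : ℤ → ZMod 8) hN
    push_cast at h1
    have h2 := (ZMod.intCast_eq_intCast_iff (3 * V ^ 2 + 2 * U ^ 2) 5 8).mp
      (by push_cast; exact key V U h1)
    have h2 : (3 * V ^ 2 + 2 * U ^ 2) % 8 = 5 % 8 := h2
    rcases abs_choice (A ^ 2 - 8 * (V * U)) with hc | hc <;> rw [hf'] at hc <;> omega

lemma sq_eq_one_of_five_mul_pow_four_add {A C : ℤ} (h : 5 * A ^ 4 + 3 = 8 * C ^ 2) :
    A ^ 2 = 1 := by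
  have hA := odd_of_pow_four (by norm_num) h
  have hA8 := Int.sq_emod_eight_of_odd hA
  wlog hC : (3 : ℤ) ∣ A ^ 2 - C generalizing C
  · refine this (C := -C) (by rw [neg_sq, h]) ?_
    have hd : (3 : ℤ) ∣ (A ^ 2 - C) * (A ^ 2 + C) := ⟨2 * A ^ 4 + 1 - 3 * C ^ 2, by
      linear_combination -h⟩
    rw [sub_neg_eq_add]
    exact (Int.prime_three.dvd_mul.mp hd).resolve_left hC
  obtain ⟨k, hk⟩ := hC
  have hf : (A ^ 2 - 8 * k) ^ 2 = 1 + 40 * k ^ 2 := by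
    obtain rfl : C = A ^ 2 - 3 * k := by linarith
    linarith
  obtain ⟨V, U, rfl, hf', hN | hN⟩ := exists_pell_split_ten hf
  · obtain ⟨hV, hU⟩ := Int.even_of_mod_eight (by norm_num) hN
    obtain ⟨u, rfl⟩ := Int.dvd_of_emod_eq_zero hU
    have hV8 := Int.sq_emod_eight_of_odd hV
    have hfpos : A ^ 2 - 8 * (V * (2 * u)) = V ^ 2 + 10 * (2 * u) ^ 2 := by
      rcases abs_choice (A ^ 2 - 8 * (V * (2 * u))) with hc | hc
      · rw [← hc, hf']
      · rw [hf'] at hc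
        have : 10 * (2 * u) ^ 2 = V ^ 2 - 1 := by linarith
        omega
    obtain ⟨a, b, r, s, hab, hu, hV2⟩ := exists_quadratic_form_of_sq (A := A) (V := V) (u := u)
      (m := 6) (by norm_num) hA hV (by push_cast; linear_combination hfpos)
      (by push_cast; linear_combination hN)
    have hu2 : u ^ 2 = (r * s) ^ 2 := by rw [← sq_abs, hu, sq_abs]
    have hval : (a * r ^ 2 - 8 * (r * s) + b * s ^ 2) ^ 2 = 1 + 40 * (r * s) ^ 2 := by
      rw [← hV2, ← hu2]; linear_combination hN
    have hu0 : u ^ 2 = 0 := by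
      have key : ∀ r s : ZMod 5, (2 * r ^ 2 - 8 * (r * s) + 3 * s ^ 2) ^ 2 = 1 + 40 * (r * s) ^ 2 →
        False := by decide +kernel
      rw [hu2]
      rcases Nat.eq_of_mul_eq_six hab with ⟨rfl, rfl⟩ | ⟨rfl, rfl⟩ | ⟨rfl, rfl⟩ | ⟨rfl, rfl⟩ <;>
        push_cast at hval
      · rw [thue_ten (r := r) (s := s) (by rw [← hval]; ring)]; ring
      · rw [thue_ten (r := s) (s := r) (by rw [mul_comm s r, ← hval]; ring)]; ring
      · have h1 := congrArg (Int.cast : ℤ → ZMod 5) hval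
        push_cast at h1
        exact (key r s h1).elim
      · have h1 := congrArg (Int.cast : ℤ → ZMod 5) hval
        push_cast at h1
        exact (key s r (by rw [mul_comm (s : ZMod 5) r, ← h1]; ring)).elim
    have hu0 : u = 0 := by simpa using hu0
    subst hu0
    linear_combination hfpos + hN
  · exfalso
    have key : ∀ v w : ZMod 8, v ^ 2 - 10 * w ^ 2 = -1 → v ^ 2 + 10 * w ^ 2 = 3 := by
      decide +kernel
    have h1 := congrArg (Int.cast : ℤ → ZMod 8) hN
    push_cast at h1
    have h2 := (ZMod.intCast_eq_intCast_iff (V ^ 2 + 10 * U ^ 2) 3 8).mp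
      (by push_cast; exact key V U h1)
    have h2 : (V ^ 2 + 10 * U ^ 2) % 8 = 3 % 8 := h2
    rcases abs_choice (A ^ 2 - 8 * (V * U)) with hc | hc <;> rw [hf'] at hc <;> omega

/-- Skolem's method for a linear functional along the powers of an element congruent to one. -/
lemma eq_zero_of_functional_mul_pow_eq_zero {R : Type*} [CommRing R] {p : ℕ} (hp : p.Prime)
    (hodd : Odd p) (φ : R →+ ℤ) {x κ : R} (hx : φ x = 0) (hκ : ¬ (p : ℤ) ∣ φ (x * κ)) {n : ℕ}
    (hn : φ (x * (1 + p * κ) ^ n) = 0) : n = 0 := by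
  by_contra hn0
  obtain ⟨v, u, hu, rfl⟩ := Nat.exists_eq_pow_mul_and_not_dvd hn0 p hp.ne_one
  obtain ⟨ρ, hρ⟩ := exists_one_add_mul_pow hodd κ v u
  have e1 : x * (1 + p * κ) ^ (p ^ v * u) =
      x + (p ^ (v + 1) : ℤ) • ((u : ℤ) • (x * κ) + (p : ℤ) • (x * ρ)) := by
    rw [hρ]
    simp only [zsmul_eq_mul]
    push_cast
    ring
  rw [e1, map_add, hx, zero_add, map_zsmul, map_add, map_zsmul, map_zsmul] at hn
  simp only [smul_eq_mul] at hn
  have hp0 : (p : ℤ) ^ (v + 1) ≠ 0 := pow_ne_zero _ (by exact_mod_cast hp.ne_zero)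
  have h0 := (mul_eq_zero.mp hn).resolve_left hp0
  have hd : (p : ℤ) ∣ u * φ (x * κ) := ⟨-φ (x * ρ), by linarith⟩
  rcases (Nat.prime_iff_prime_int.mp hp).dvd_mul.mp hd with h | h
  · exact hu (by exact_mod_cast h)
  · exact hκ h

/-- The ring `ℤ[∛2]`, an element being `a + b ∛2 + c ∛4`. -/
@[ext]
structure CubicOrder where
  a : ℤ
  b : ℤ
  c : ℤ
  deriving DecidableEq

namespace CubicOrder

instance : Zero CubicOrder := ⟨⟨0, 0, 0⟩⟩
instance : One CubicOrder := ⟨⟨1, 0, 0⟩⟩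
instance : Add CubicOrder := ⟨fun x y => ⟨x.a + y.a, x.b + y.b, x.c + y.c⟩⟩
instance : Neg CubicOrder := ⟨fun x => ⟨-x.a, -x.b, -x.c⟩⟩
instance : Mul CubicOrder := ⟨fun x y => ⟨x.a * y.a + 2 * (x.b * y.c + x.c * y.b),
  x.a * y.b + x.b * y.a + 2 * (x.c * y.c), x.a * y.c + x.b * y.b + x.c * y.a⟩⟩

@[simp] lemma zero_def : (0 : CubicOrder) = ⟨0, 0, 0⟩ := rfl
@[simp] lemma one_def : (1 : CubicOrder) = ⟨1, 0, 0⟩ := rfl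
@[simp] lemma add_def (x y : CubicOrder) : x + y = ⟨x.a + y.a, x.b + y.b, x.c + y.c⟩ := rfl
@[simp] lemma neg_def (x : CubicOrder) : -x = ⟨-x.a, -x.b, -x.c⟩ := rfl
@[simp] lemma mul_def (x y : CubicOrder) : x * y = ⟨x.a * y.a + 2 * (x.b * y.c + x.c * y.b),
  x.a * y.b + x.b * y.a + 2 * (x.c * y.c), x.a * y.c + x.b * y.b + x.c * y.a⟩ := rfl

instance : CommRing CubicOrder where
  add_assoc x y z := by ext <;> simp <;> ring
  zero_add x := by ext <;> simp
  add_zero x := by ext <;> simp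
  add_comm x y := by ext <;> simp <;> ring
  neg_add_cancel x := by ext <;> simp
  left_distrib x y z := by ext <;> simp <;> ring
  right_distrib x y z := by ext <;> simp <;> ring
  zero_mul x := by ext <;> simp
  mul_zero x := by ext <;> simp
  mul_assoc x y z := by ext <;> simp <;> ring
  one_mul x := by ext <;> simp
  mul_one x := by ext <;> simp
  mul_comm x y := by ext <;> simp <;> ring
  nsmul := nsmulRec
  zsmul := zsmulRec

/-- The coefficient of `∛4`. -/
def coeffC : CubicOrder →+ ℤ where
  toFun x := x.c
  map_zero' := rfl
  map_add' _ _ := rfl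

/-- The rational coefficient. -/
def coeffA : CubicOrder →+ ℤ where
  toFun x := x.a
  map_zero' := rfl
  map_add' _ _ := rfl

/-- The norm form. -/
def norm (x : CubicOrder) : ℤ := x.a ^ 3 + 2 * x.b ^ 3 + 4 * x.c ^ 3 - 6 * x.a * x.b * x.c

lemma norm_mul (x y : CubicOrder) : norm (x * y) = norm x * norm y := by
  simp only [norm, mul_def]
  ring

/-- The real embedding attached to a real cube root `t` of two. -/
def toReal (t : ℝ) (ht : t ^ 3 = 2) : CubicOrder →* ℝ where
  toFun x := x.a + x.b * t + x.c * t ^ 2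
  map_one' := by simp
  map_mul' x y := by
    simp only [mul_def]
    push_cast
    linear_combination (-(x.b * y.c + x.c * y.b : ℝ) - x.c * y.c * t) * ht

/-- The fundamental unit `1 + ∛2 + ∛4`. -/
def unit : CubicOrderˣ := ⟨⟨1, 1, 1⟩, ⟨-1, 1, 0⟩, rfl, rfl⟩

lemma norm_unit_pow (u : CubicOrderˣ) (hu : norm (u : CubicOrder) = 1) (k : ℤ) :
    norm ((u ^ k : CubicOrderˣ) : CubicOrder) = 1 := by
  let f : CubicOrder →* ℤ := ⟨⟨norm, rfl⟩, norm_mul⟩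
  have h1 : Units.map f u = 1 := Units.ext hu
  have h2 : Units.map f (u ^ k) = 1 := by rw [map_zpow, h1, one_zpow]
  exact congrArg Units.val h2

lemma exists_reduced {x : CubicOrder} {N : ℤ} (hN : norm x = N) (hN0 : N ≠ 0) (hN15 : |N| ≤ 15) :
    ∃ (k : ℤ) (y : CubicOrder), x = y * (unit ^ k : CubicOrderˣ) ∧ norm y = N ∧
      |y.a| ≤ 3 ∧ |y.b| ≤ 3 ∧ |y.c| ≤ 2 := by
  obtain ⟨t, ht0, ht⟩ : ∃ t : ℝ, 0 ≤ t ∧ t ^ 3 = 2 :=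
    ⟨2 ^ (1 / 3 : ℝ), by positivity, by
      rw [← Real.rpow_natCast, ← Real.rpow_mul (by norm_num)]; norm_num⟩
  have ht1 : 1.259 < t := by
    by_contra h
    push Not at h
    have := pow_le_pow_left₀ ht0 h 3
    norm_num at this
    linarith
  have ht2 : t < 1.26 := by
    by_contra h
    push Not at h
    have := pow_le_pow_left₀ (by norm_num) h 3
    norm_num at this
    linarith
  have hfac : ∀ z : CubicOrder, 2 * (norm z : ℝ) = toReal t ht z * ((z.a - z.b * t) ^ 2 +
      (z.b * t - z.c * t ^ 2) ^ 2 + (z.c * t ^ 2 - z.a) ^ 2) := by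
    intro z
    simp only [norm, toReal, MonoidHom.coe_mk, OneHom.coe_mk]
    push_cast
    linear_combination (-2 * (z.b : ℝ) ^ 3 - 2 * z.c ^ 3 * (t ^ 3 + 2) + 6 * z.a * z.b * z.c) * ht
  have hu : toReal t ht (unit : CubicOrder) = 1 + t + t ^ 2 := by simp [toReal, unit]
  have hx0 : toReal t ht x ≠ 0 := by
    intro h
    have := hfac x
    rw [h, zero_mul, hN] at this
    have : (N : ℝ) = 0 := by linarith
    exact hN0 (by exact_mod_cast this)
  obtain ⟨k, hk1, hk2⟩ := exists_mem_Ico_zpow (x := |toReal t ht x|) (y := 1 + t + t ^ 2)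
    (abs_pos.mpr hx0) (by nlinarith)
  have hval : ∀ j : ℤ, toReal t ht ((unit ^ j : CubicOrderˣ) : CubicOrder) =
      (1 + t + t ^ 2) ^ j := by
    intro j
    rw [← hu, ← Units.coe_map, map_zpow, Units.val_zpow_eq_zpow_val, Units.coe_map]
  refine ⟨k, x * (unit ^ (-k) : CubicOrderˣ), ?_, ?_, ?_⟩
  · rw [mul_assoc, ← Units.val_mul, ← zpow_add, neg_add_cancel, zpow_zero, Units.val_one, mul_one]
  · rw [norm_mul, norm_unit_pow _ (by rfl), mul_one, hN]
  · set y := x * ((unit ^ (-k) : CubicOrderˣ) : CubicOrder) with hy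
    have hNy : norm y = N := by rw [hy, norm_mul, norm_unit_pow _ (by rfl), mul_one, hN]
    have hvy : |toReal t ht y| = |toReal t ht x| * (1 + t + t ^ 2) ^ (-k) := by
      rw [hy, map_mul, hval, abs_mul, abs_of_pos (a := (1 + t + t ^ 2) ^ (-k)) (by positivity)]
    have hpos : 0 < (1 + t + t ^ 2) ^ k := by positivity
    rw [zpow_neg, ← div_eq_mul_inv] at hvy
    have h1 : 1 ≤ |toReal t ht y| := by rw [hvy, le_div_iff₀ hpos, one_mul]; exact hk1
    have h2 : |toReal t ht y| < 3.85 := by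
      rw [hvy, div_lt_iff₀ hpos]
      refine hk2.trans_le ?_
      rw [zpow_add_one₀ (by positivity), mul_comm]
      gcongr
      nlinarith
    have hq := hfac y
    rw [hNy] at hq
    have hq' := congrArg abs hq
    rw [abs_mul, abs_mul, abs_two] at hq'
    have hNr : |(N : ℝ)| ≤ 15 := by exact_mod_cast hN15
    set S := (y.a - y.b * t) ^ 2 + (y.b * t - y.c * t ^ 2) ^ 2 + (y.c * t ^ 2 - y.a) ^ 2 with hS
    have hS0 : 0 ≤ S := by positivity
    rw [abs_of_nonneg hS0] at hq'
    have hS30 : S ≤ 30 := by nlinarith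
    rw [hS] at hS30
    have ht2' : 1.585 < t ^ 2 := by nlinarith
    have hv : toReal t ht y = y.a + y.b * t + y.c * t ^ 2 := rfl
    rw [hv, abs_lt] at h2
    clear_value S
    generalize y.a = a at *
    generalize y.b = b at *
    generalize y.c = c at *
    have hd : ∀ P Q W : ℝ, (P - Q) ^ 2 + (Q - W) ^ 2 + (W - P) ^ 2 ≤ 30 → -3.85 < P + Q + W →
        P + Q + W < 3.85 → |P| < 3.9 := by
      intro P Q W hPQ h3 h4
      have h6 : (2 * P - Q - W) ^ 2 ≤ 60 := by nlinarith [sq_nonneg (Q - W)]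
      have h7 : |2 * P - Q - W| < 7.75 := by
        rw [← sq_lt_sq₀ (abs_nonneg _) (by norm_num), sq_abs]; norm_num; linarith
      rw [abs_lt] at *
      constructor <;> linarith
    have hA := hd a (b * t) (c * t ^ 2) hS30 h2.1 h2.2
    have hB := hd (b * t) (c * t ^ 2) a (by linarith) (by linarith) (by linarith)
    have hC := hd (c * t ^ 2) a (b * t) (by linarith) (by linarith) (by linarith)
    rw [abs_mul, abs_of_pos (by positivity : (0:ℝ) < t)] at hB
    rw [abs_mul, abs_of_pos (by positivity : (0:ℝ) < t ^ 2)] at hC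
    have hB' : |(b : ℝ)| < 4 := by nlinarith [abs_nonneg (b : ℝ)]
    have hC' : |(c : ℝ)| < 3 := by nlinarith [abs_nonneg (c : ℝ)]
    have hA' : |(a : ℝ)| < 4 := by linarith
    have hA'' : |a| < 4 := by exact_mod_cast hA'
    have hB'' : |b| < 4 := by exact_mod_cast hB'
    have hC'' : |c| < 3 := by exact_mod_cast hC'
    refine ⟨by omega, by omega, by omega⟩

lemma exponent_eq_zero {x η κ κ' : CubicOrder} {P p M d : ℕ} (hp : p.Prime) (hodd : Odd p)
    (hx : x.c = 0) (hκ : η ^ P = 1 + p * κ) (hκ' : η ^ P = 1 + M * κ') (hd : d ∣ M)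
    (hxκ : ¬ (p : ℤ) ∣ (x * κ).c) (hP : 0 < P)
    (hr : ∀ r < P, (M : ℤ) ∣ (x * η ^ r).c → (d : ℤ) ∣ (x * η ^ r).a → r = 0) {n : ℕ}
    (hc : (x * η ^ n).c = 0) (ha : (d : ℤ) ∣ (x * η ^ n).a) : n = 0 := by
  obtain ⟨ρ, hρ⟩ : (M : CubicOrder) ∣ x * η ^ n - x * η ^ (n % P) := by
    have h1 : x * η ^ n - x * η ^ (n % P) =
        x * η ^ (n % P) * ((η ^ P) ^ (n / P) - 1 ^ (n / P)) := by
      rw [one_pow, mul_sub, mul_one, mul_assoc, ← pow_mul, ← pow_add, Nat.mod_add_div]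
    rw [h1]
    refine Dvd.dvd.mul_left (dvd_trans ?_ (sub_dvd_pow_sub_pow _ _ _)) _
    rw [hκ']
    exact ⟨κ', by ring⟩
  have hMρ : (M : CubicOrder) * ρ = (M : ℤ) • ρ := by rw [zsmul_eq_mul]; norm_cast
  have hC : (x * η ^ n).c - (x * η ^ (n % P)).c = M * ρ.c := by
    have := congrArg coeffC hρ
    rwa [hMρ, map_zsmul, map_sub] at this
  have hA : (x * η ^ n).a - (x * η ^ (n % P)).a = M * ρ.a := by
    have := congrArg coeffA hρ
    rwa [hMρ, map_zsmul, map_sub] at this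
  have h0 : n % P = 0 := by
    refine hr _ (Nat.mod_lt _ hP) ⟨-ρ.c, by linarith⟩ ?_
    have : (d : ℤ) ∣ M * ρ.a := (Int.natCast_dvd_natCast.mpr hd).mul_right _
    rw [← hA] at this
    simpa using (dvd_sub ha this)
  obtain ⟨q, rfl⟩ := Nat.dvd_of_mod_eq_zero h0
  rw [pow_mul, hκ] at hc
  rw [eq_zero_of_functional_mul_pow_eq_zero hp hodd coeffC hx hxκ hc, mul_zero]

lemma exists_pow_of_zpow (k : ℤ) : ∃ n : ℕ,
    ((unit ^ k : CubicOrderˣ) : CubicOrder) = (⟨1, 1, 1⟩ : CubicOrder) ^ n ∨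
    ((unit ^ k : CubicOrderˣ) : CubicOrder) = (⟨-1, 1, 0⟩ : CubicOrder) ^ n := by
  obtain ⟨n, rfl | rfl⟩ := k.eq_nat_or_neg
  · exact ⟨n, Or.inl (by rw [zpow_natCast, Units.val_pow_eq_pow_val]; rfl)⟩
  · refine ⟨n, Or.inr ?_⟩
    rw [zpow_neg, ← inv_zpow, zpow_natCast, Units.val_pow_eq_pow_val]
    rfl

lemma base_fifteen : ∀ a ∈ Finset.Icc (-3 : ℤ) 3, ∀ b ∈ Finset.Icc (-3 : ℤ) 3,
    ∀ c ∈ Finset.Icc (-2 : ℤ) 2, norm ⟨a, b, c⟩ = -15 →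
    ∃ j ∈ Finset.range 3, (⟨a, b, c⟩ : CubicOrder) * ⟨1, 1, 1⟩ = ⟨1, -2, 0⟩ * ⟨1, 1, 1⟩ ^ j := by
  decide +kernel

lemma base_three : ∀ a ∈ Finset.Icc (-3 : ℤ) 3, ∀ b ∈ Finset.Icc (-3 : ℤ) 3,
    ∀ c ∈ Finset.Icc (-2 : ℤ) 2, norm ⟨a, b, c⟩ = -3 →
    ∃ j ∈ Finset.range 6, (⟨a, b, c⟩ : CubicOrder) * ⟨1, 1, 1⟩ = ⟨5, -4, 0⟩ * ⟨1, 1, 1⟩ ^ j := by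
  decide +kernel

lemma exists_eq_mul_zpow {x π : CubicOrder} {N : ℤ} {J : ℕ} (hN : norm x = N) (hN0 : N ≠ 0)
    (hN15 : |N| ≤ 15) (hbase : ∀ a ∈ Finset.Icc (-3 : ℤ) 3, ∀ b ∈ Finset.Icc (-3 : ℤ) 3,
      ∀ c ∈ Finset.Icc (-2 : ℤ) 2, norm ⟨a, b, c⟩ = N →
      ∃ j ∈ Finset.range J, (⟨a, b, c⟩ : CubicOrder) * ⟨1, 1, 1⟩ = π * ⟨1, 1, 1⟩ ^ j) :
    ∃ k : ℤ, x = π * (unit ^ k : CubicOrderˣ) := by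
  obtain ⟨k, y, rfl, hy, ha, hb, hc⟩ := exists_reduced hN hN0 hN15
  rw [abs_le] at ha hb hc
  obtain ⟨j, -, hj⟩ := hbase y.a (Finset.mem_Icc.mpr ha) y.b (Finset.mem_Icc.mpr hb) y.c
    (Finset.mem_Icc.mpr hc) hy
  refine ⟨j + (k - 1), ?_⟩
  have hu : (⟨1, 1, 1⟩ : CubicOrder) = (unit : CubicOrder) := rfl
  rw [hu] at hj
  have e1 : (unit ^ k : CubicOrderˣ) = unit * unit ^ (k - 1) := by
    rw [← zpow_one_add]; congr 1; ring
  rw [e1, Units.val_mul, ← mul_assoc, show y * (unit : CubicOrder) = _ from hj, zpow_add,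
    zpow_natCast, Units.val_mul, Units.val_pow_eq_pow_val, mul_assoc]

end CubicOrder

open CubicOrder in
lemma eq_one_of_cube_add_fifteen {X B : ℤ} (h : X ^ 3 + 15 = 2 * B ^ 3) : X = 1 := by
  obtain ⟨k, hk⟩ := exists_eq_mul_zpow (x := ⟨X, -B, 0⟩) (N := -15)
    (by simp only [CubicOrder.norm]; linarith) (by norm_num) (by norm_num) base_fifteen
  obtain ⟨n, hn | hn⟩ := exists_pow_of_zpow k <;> rw [hn] at hk <;>
  have hc := congrArg CubicOrder.c hk
  · have : n = 0 := exponent_eq_zero (P := 30) (p := 31) (M := 93) (d := 1)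
      (κ := ⟨3857211687964320, 3061470945569298, 2429891099783391⟩)
      (κ' := ⟨3857211687964320 / 3, 3061470945569298 / 3, 2429891099783391 / 3⟩)
      (by norm_num) (by decide) rfl (by decide +kernel) (by decide +kernel) (by norm_num)
      (by decide +kernel) (by norm_num) (by decide +kernel) hc.symm (by simp)
    subst this
    simpa using congrArg CubicOrder.a hk
  · have : n = 0 := exponent_eq_zero (P := 30) (p := 31) (M := 93) (d := 1)
      (κ := ⟨5232924, 6013164, -8069187⟩)
      (κ' := ⟨5232924 / 3, 6013164 / 3, -8069187 / 3⟩)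
      (by norm_num) (by decide) rfl (by decide +kernel) (by decide +kernel) (by norm_num)
      (by decide +kernel) (by norm_num) (by decide +kernel) hc.symm (by simp)
    subst this
    simpa using congrArg CubicOrder.a hk

open CubicOrder in
lemma eq_five_of_cube_add_three {X B : ℤ} (h : X ^ 3 + 3 = 2 * B ^ 3) (h5 : 5 ∣ X) :
    X = 5 ∧ B = 4 := by
  obtain ⟨k, hk⟩ := exists_eq_mul_zpow (x := ⟨X, -B, 0⟩) (N := -3)
    (by simp only [CubicOrder.norm]; linarith) (by norm_num) (by norm_num) base_three
  obtain ⟨n, hn | hn⟩ := exists_pow_of_zpow k <;> rw [hn] at hk <;>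
  have hc := congrArg CubicOrder.c hk <;> have ha := congrArg CubicOrder.a hk
  · have : n = 0 := exponent_eq_zero (P := 40) (p := 11) (M := 55) (d := 5)
      (κ := ⟨7723745531355229200000, 6130340890803985326500, 4865654789492957686400⟩)
      (κ' := ⟨7723745531355229200000 / 5, 6130340890803985326500 / 5,
        4865654789492957686400 / 5⟩)
      (by norm_num) (by decide) rfl (by decide +kernel) (by decide +kernel) (by norm_num)
      (by decide +kernel) (by norm_num) (by decide +kernel) hc.symm (by rw [← ha]; exact h5)
    subst this
    have hb := congrArg CubicOrder.b hk
    simp at ha hb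
    exact ⟨ha, hb⟩
  · have : n = 0 := exponent_eq_zero (P := 40) (p := 11) (M := 55) (d := 5)
      (κ := ⟨1047200000, 20603793500, -17012936400⟩)
      (κ' := ⟨1047200000 / 5, 20603793500 / 5, -17012936400 / 5⟩)
      (by norm_num) (by decide) rfl (by decide +kernel) (by decide +kernel) (by norm_num)
      (by decide +kernel) (by norm_num) (by decide +kernel) hc.symm (by rw [← ha]; exact h5)
    subst this
    have hb := congrArg CubicOrder.b hk
    simp at ha hb
    exact ⟨ha, hb⟩

/-- Whether `a` has multiplicative order `2 * k * ℓ` modulo `2 * k * ℓ + 1`, for `ℓ` prime. -/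
def isGenerator (ℓ k a : ℕ) : Bool :=
  (a ^ (2 * ℓ) % (2 * k * ℓ + 1)) ^ k % (2 * k * ℓ + 1) == 1 &&
  a ^ (2 * k) % (2 * k * ℓ + 1) != 1 &&
  (List.range (2 * k + 1)).all fun p => p < 2 || 2 * k % p != 0 ||
    (a ^ ℓ % (2 * k * ℓ + 1)) ^ (2 * k / p) % (2 * k * ℓ + 1) != 1

/-- Whether `β * b - c` is never `u` modulo `q`, for `b` either zero or a root of unity of order
dividing `2 * k`. -/
def avoids (q β c k u : ℕ) : Bool :=
  (u + c) % q != 0 && (u + c) ^ (2 * k) % q != β ^ (2 * k) % q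

/-- Whether `X ^ ℓ + c = β * B ^ ℓ`, with `X` a square, is impossible modulo `2 * k * ℓ + 1`. -/
def isObstruction (ℓ β c k : ℕ) : Bool :=
  (2 ^ (2 * ℓ) % (2 * k * ℓ + 1)) ^ k % (2 * k * ℓ + 1) == 1 &&
  avoids (2 * k * ℓ + 1) β c k 0 &&
  match (List.range 60).find? (isGenerator ℓ k) with
  | none => false
  | some a => (List.range k).all fun j =>
      avoids (2 * k * ℓ + 1) β c k ((a ^ (2 * ℓ) % (2 * k * ℓ + 1)) ^ j % (2 * k * ℓ + 1))

lemma orderOf_of_isGenerator {ℓ k a : ℕ} (hℓ : ℓ.Prime) (hk : 0 < k)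
    (h : isGenerator ℓ k a = true) : orderOf (a : ZMod (2 * k * ℓ + 1)) = 2 * k * ℓ := by
  set q := 2 * k * ℓ + 1 with hq
  have hkℓ : 0 < 2 * k * ℓ := by have := hℓ.pos; positivity
  have key : ∀ n : ℕ, (n : ZMod q) = 1 ↔ n % q = 1 := by
    intro n
    rw [← Nat.cast_one, ZMod.natCast_eq_natCast_iff', Nat.mod_eq_of_lt (a := 1) (by omega)]
  simp only [isGenerator, ← hq, Bool.and_eq_true, beq_iff_eq, bne_iff_ne, List.all_eq_true,
    List.mem_range, Bool.or_eq_true, decide_eq_true_eq] at h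
  obtain ⟨⟨h1, h2⟩, h3⟩ := h
  rw [← key] at h1
  rw [Ne, ← key] at h2
  push_cast [ZMod.natCast_mod] at h1 h2
  refine orderOf_eq_of_pow_and_pow_div_prime hkℓ ?_ ?_
  · rw [← pow_mul] at h1
    rw [← h1]
    congr 1
    ring
  · intro p hp hdvd
    rcases (Nat.Prime.dvd_mul hp).mp hdvd with hd | hd
    · obtain ⟨e, he⟩ := hd
      have hpk : p ≤ 2 * k := Nat.le_of_dvd (by omega) ⟨e, he⟩
      have h4 := h3 p (by omega)
      have hp2 := hp.two_le
      have : ¬ p < 2 := by omega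
      have h5 : 2 * k % p = 0 := by rw [he]; simp
      simp only [this, h5, not_true_eq_false, or_self, false_or, ← key, ne_eq] at h4
      push_cast [ZMod.natCast_mod] at h4
      rw [← pow_mul] at h4
      convert h4 using 3
      rw [he, Nat.mul_div_cancel_left _ hp.pos, mul_assoc, Nat.mul_div_cancel_left _ hp.pos,
        mul_comm]
    · rw [(Nat.prime_dvd_prime_iff_eq hp hℓ).mp hd, Nat.mul_div_cancel _ hℓ.pos]
      exact h2

lemma no_solution_of_isObstruction {ℓ β c k : ℕ} (hℓ : ℓ.Prime) (hk : 0 < k)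
    (h : isObstruction ℓ β c k = true) (t B : ℕ) : (t ^ 2) ^ ℓ + c ≠ β * B ^ ℓ := by
  intro heq
  have hkℓ : 0 < 2 * k * ℓ := by have := hℓ.pos; positivity
  simp only [isObstruction, Bool.and_eq_true] at h
  obtain ⟨⟨-, h0⟩, h⟩ := h
  split at h
  · simp at h
  rename_i a ha
  have hord := orderOf_of_isGenerator hℓ hk (List.find?_some ha)
  set q := 2 * k * ℓ + 1 with hq
  have hprime : q.Prime := by
    refine lucas_primality q (a : ZMod q) ?_ ?_
    · rw [hq, Nat.add_sub_cancel, ← hq, ← hord, pow_orderOf_eq_one]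
    · intro p hp hd
      rw [hq, Nat.add_sub_cancel] at hd ⊢
      rw [← hq]
      refine pow_ne_one_of_lt_orderOf (Nat.div_pos (Nat.le_of_dvd hkℓ hd) hp.pos).ne' ?_
      rw [hord]
      exact Nat.div_lt_self hkℓ hp.one_lt
  have : Fact q.Prime := ⟨hprime⟩
  have hroot : IsPrimitiveRoot ((a : ZMod q) ^ (2 * ℓ)) k := by
    have := IsPrimitiveRoot.orderOf (a : ZMod q)
    rw [hord] at this
    exact this.pow hkℓ (by ring)
  have hfermat : ∀ z : ZMod q, z ≠ 0 → z ^ (2 * k * ℓ) = 1 := by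
    intro z hz
    have := ZMod.pow_card_sub_one_eq_one hz
    rwa [show q - 1 = 2 * k * ℓ by omega] at this
  have hz : ((t : ZMod q) ^ 2) ^ ℓ + c = β * (B : ZMod q) ^ ℓ := by exact_mod_cast congrArg _ heq
  have havoid : ∀ u : ℕ, avoids q β c k u = true → (u : ZMod q) ≠ ((t : ZMod q) ^ 2) ^ ℓ := by
    intro u hu heq'
    simp only [avoids, Bool.and_eq_true, bne_iff_ne] at hu
    obtain ⟨hu1, hu2⟩ := hu
    rw [← heq'] at hz
    by_cases hB : (B : ZMod q) = 0
    · rw [hB, zero_pow hℓ.ne_zero, mul_zero] at hz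
      apply hu1
      have : ((u + c : ℕ) : ZMod q) = 0 := by exact_mod_cast hz
      exact Nat.mod_eq_zero_of_dvd ((ZMod.natCast_eq_zero_iff _ _).mp this)
    · apply hu2
      rw [← Nat.ModEq, ← ZMod.natCast_eq_natCast_iff]
      push_cast
      rw [hz, mul_pow, ← pow_mul, mul_comm ℓ, hfermat _ hB, mul_one]
  by_cases ht : (t : ZMod q) = 0
  · refine havoid 0 h0 ?_
    rw [ht]
    simp [hℓ.ne_zero]
  · have h1 : (((t : ZMod q) ^ 2) ^ ℓ) ^ k = 1 := by
      rw [← hfermat _ ht]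
      ring
    have : NeZero k := ⟨hk.ne'⟩
    obtain ⟨j, hj, hj'⟩ := hroot.eq_pow_of_pow_eq_one h1
    rw [List.all_eq_true] at h
    refine havoid _ (h j (List.mem_range.mpr hj)) ?_
    push_cast [ZMod.natCast_mod]
    exact hj'

/-- A fast sufficient criterion for `ℓ` to be composite: the large number is the product of the
primes below one hundred. -/
def isComposite (ℓ : ℕ) : Bool :=
  ℓ.gcd 2305567963945518424753102147331756070 != 1 &&
    (97 < ℓ || [2, 3, 5, 7].any fun p => p < ℓ && ℓ % p == 0)

lemma not_prime_of_isComposite {ℓ : ℕ} (h : isComposite ℓ = true) : ¬ ℓ.Prime := by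
  intro hℓ
  simp only [isComposite, Bool.and_eq_true, Bool.or_eq_true, decide_eq_true_eq, bne_iff_ne,
    List.any_eq_true, beq_iff_eq] at h
  rcases h with ⟨h1, h2 | ⟨p, hp, hlt, hmod⟩⟩
  · have hdvd := (Nat.coprime_or_dvd_of_prime hℓ
      2305567963945518424753102147331756070).resolve_left h1
    rw [show 2305567963945518424753102147331756070 =
      2 * 3 * 5 * 7 * 11 * 13 * 17 * 19 * 23 * 29 * 31 * 37 * 41 * 43 * 47 * 53 * 59 * 61 *
      67 * 71 * 73 * 79 * 83 * 89 * 97 by norm_num] at hdvd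
    simp only [hℓ.dvd_mul] at hdvd
    have : ∀ n : ℕ, 0 < n → n ≤ 97 → ¬ ℓ ∣ n := fun n hn hn' hd => by
      have := Nat.le_of_dvd hn hd
      omega
    simp [this] at hdvd
  · rcases (Nat.dvd_prime hℓ).mp (Nat.dvd_of_mod_eq_zero hmod) with rfl | rfl
    · simp at hp
    · exact absurd hlt (lt_irrefl _)

/-- Search for obstructions modulo `2 * k * ℓ + 1` with `0 < k ≤ 40` to four equations, unless
`ℓ` is visibly composite. -/
def hasObstructions (ℓ : ℕ) : Bool :=
  isComposite ℓ || [(2, 15), (54, 135), (250, 375), (6750, 3375)].all fun s =>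
    (List.range 40).any fun k => isObstruction ℓ s.1 s.2 (k + 1)

lemma hasObstructions_of_lt : ((List.range 10000).all fun i => hasObstructions (i + 5)) = true := by
  decide +kernel

lemma no_solution_of_lt {ℓ β c : ℕ} (hℓ : ℓ.Prime) (h5 : 5 ≤ ℓ) (hlt : ℓ < 10000)
    (hs : (β, c) ∈ [(2, 15), (54, 135), (250, 375), (6750, 3375)]) (t B : ℕ) :
    (t ^ 2) ^ ℓ + c ≠ β * B ^ ℓ := by
  have h := List.all_eq_true.mp hasObstructions_of_lt (ℓ - 5) (List.mem_range.mpr (by omega))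
  rw [Nat.sub_add_cancel h5, hasObstructions, Bool.or_eq_true] at h
  rcases h with h | h
  · exact absurd hℓ (not_prime_of_isComposite h)
  · obtain ⟨k, -, h⟩ := List.any_eq_true.mp (List.all_eq_true.mp h _ hs)
    exact no_solution_of_isObstruction hℓ k.succ_pos h t B

open Finset in
lemma exists_submatrix_det_ne_zero {N : ℕ} {ι : Type} (E : Fin N → ι → ℝ)
    (h : ∀ v : Fin N → ℝ, (∀ p, ∑ a, v a * E a p = 0) → v = 0) :
    ∃ col : Fin N → ι, Function.Injective col ∧
      (Matrix.of fun a n => E a (col n)).det ≠ 0 := by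
  set u : ι → (Fin N → ℝ) := fun p a => E a p with hu
  have hspan : Submodule.span ℝ (Set.range u) = ⊤ := by
    by_contra hne
    obtain ⟨f, hf, hker⟩ := Submodule.exists_le_ker_of_lt_top _ (lt_top_iff_ne_top.mpr hne)
    have hv : (fun a => f (Pi.single a 1)) = 0 := by
      apply h
      intro p
      have h1 : f (u p) = 0 := hker (Submodule.subset_span ⟨p, rfl⟩)
      rw [LinearMap.pi_apply_eq_sum_univ] at h1
      rw [← h1]
      refine sum_congr rfl fun a _ => ?_
      rw [smul_eq_mul, mul_comm]
      congr 2
      ext b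
      simp [Pi.single_apply, eq_comm]
    apply hf
    apply LinearMap.pi_ext'
    intro a
    ext
    simpa using congrFun hv a
  obtain ⟨κ, c, hc, hsp, hli⟩ := exists_linearIndependent' ℝ u
  have hb := Module.Basis.mk hli (by rw [hsp, hspan])
  have hfin : Finite κ := Module.Finite.finite_basis hb
  have hfint := Fintype.ofFinite κ
  have hcard : Fintype.card κ = N := by
    rw [← Module.finrank_eq_card_basis hb, Module.finrank_fin_fun]
  let e := Fintype.equivFinOfCardEq hcard
  refine ⟨c ∘ e.symm, hc.comp e.symm.injective, ?_⟩
  have hcols : LinearIndependent ℝ (Matrix.of fun a n => E a ((c ∘ e.symm) n)).col :=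
    hli.comp e.symm e.symm.injective
  have := Matrix.linearIndependent_cols_iff_isUnit.mp hcols
  rw [Matrix.isUnit_iff_isUnit_det] at this
  exact this.ne_zero

lemma exists_eq_sum_add_pow_mul {f : ℂ → ℂ} (hf : Differentiable ℂ f) (N : ℕ) :
    ∃ (c : ℕ → ℂ) (g : ℂ → ℂ), Differentiable ℂ g ∧
      ∀ z, f z = ∑ t ∈ Finset.range N, c t * z ^ t + z ^ N * g z := by
  induction N with
  | zero => exact ⟨0, f, hf, by simp⟩
  | succ N ih =>
    obtain ⟨c, g, hg, h⟩ := ih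
    refine ⟨fun t => if t = N then g 0 else c t, dslope g 0, ?_, fun z => ?_⟩
    · rw [← differentiableOn_univ]
      exact (Complex.differentiableOn_dslope Filter.univ_mem).mpr hg.differentiableOn
    · have h1 := sub_smul_dslope g 0 z
      rw [sub_zero, smul_eq_mul] at h1
      rw [h z, Finset.sum_range_succ]
      beta_reduce
      rw [if_pos rfl, pow_succ, mul_assoc, h1]
      have : ∑ t ∈ Finset.range N, (if t = N then g 0 else c t) * z ^ t =
          ∑ t ∈ Finset.range N, c t * z ^ t :=
        Finset.sum_congr rfl fun t ht => by rw [if_neg (Finset.mem_range.mp ht).ne]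
      rw [this]
      ring

lemma norm_det_le_of_row_bound {N : ℕ} (A : Matrix (Fin N) (Fin N) ℂ) (M : Fin N → ℝ)
    (h : ∀ a n, ‖A a n‖ ≤ M a) : ‖A.det‖ ≤ N.factorial * ∏ a, M a := by
  rw [Matrix.det_apply']
  refine (norm_sum_le _ _).trans ?_
  have h1 : ∀ σ ∈ (Finset.univ : Finset (Equiv.Perm (Fin N))),
      ‖((Equiv.Perm.sign σ : ℤ) : ℂ) * ∏ i, A (σ i) i‖ ≤ ∏ a, M a := by
    intro σ _
    have hs : ‖((Equiv.Perm.sign σ : ℤ) : ℂ)‖ = 1 := by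
      rcases Int.units_eq_one_or (Equiv.Perm.sign σ) with h | h <;> simp [h]
    rw [norm_mul, hs, one_mul, norm_prod, ← Equiv.prod_comp σ M]
    exact Finset.prod_le_prod (fun i _ => norm_nonneg _) fun i _ => h _ _
  refine (Finset.sum_le_sum h1).trans ?_
  simp [Fintype.card_perm]

/-- The determinant of the values of `N` entire functions at `N` points vanishes to order
`N (N - 1) / 2` when the points are contracted to the origin. -/
lemma exists_det_eq_pow_mul {N : ℕ} {f : Fin N → ℂ → ℂ} (hf : ∀ a, Differentiable ℂ (f a))
    {z : Fin N → ℂ} (hz : Function.Injective z) (e : Fin N → Fin N → ℂ) :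
    ∃ H : ℂ → ℂ, Differentiable ℂ H ∧ ∀ x,
      (Matrix.of fun a n => f a (x * z n) + x ^ N * e a n).det =
        x ^ (∑ t : Fin N, (t : ℕ)) * H x := by
  choose c g hg h using fun a => exists_eq_sum_add_pow_mul (hf a) N
  set V : Matrix (Fin N) (Fin N) ℂ := (Matrix.vandermonde z).transpose with hV
  have hVdet : IsUnit V.det := by
    rw [hV, Matrix.det_transpose, isUnit_iff_ne_zero]
    exact Matrix.det_vandermonde_ne_zero_iff.mpr hz
  set Q : ℂ → Matrix (Fin N) (Fin N) ℂ := fun x =>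
    (Matrix.of fun a n => z n ^ N * g a (x * z n) + e a n) * V⁻¹ with hQ
  have hQd : ∀ a t, Differentiable ℂ fun x => Q x a t := by
    intro a t
    simp only [hQ, Matrix.mul_apply, Matrix.of_apply]
    have := hg a
    fun_prop
  refine ⟨fun x => (Matrix.of fun a t : Fin N => c a t + x ^ (N - t : ℕ) * Q x a t).det * V.det,
    ?_, fun x => ?_⟩
  · simp only [Matrix.det_apply', Matrix.of_apply]
    have : ∀ a t, Differentiable ℂ fun x => Q x a t := hQd
    fun_prop
  · have key : (Matrix.of fun a n => f a (x * z n) + x ^ N * e a n) =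
        (Matrix.of fun a t : Fin N => x ^ (t : ℕ) *
          (Matrix.of fun a t : Fin N => c a t + x ^ (N - t : ℕ) * Q x a t) a t) * V := by
      have e1 : (Matrix.of fun a t : Fin N => x ^ (t : ℕ) *
          (Matrix.of fun a t : Fin N => c a t + x ^ (N - t : ℕ) * Q x a t) a t) =
          (Matrix.of fun a t : Fin N => x ^ (t : ℕ) * c a t) + x ^ N • Q x := by
        ext a t
        simp only [Matrix.of_apply, Matrix.add_apply, Matrix.smul_apply, smul_eq_mul]
        rw [mul_add, ← mul_assoc, ← pow_add, Nat.add_sub_cancel' t.2.le]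
      rw [e1, Matrix.add_mul, Matrix.smul_mul, hQ, Matrix.mul_assoc, Matrix.nonsing_inv_mul _ hVdet,
        Matrix.mul_one]
      ext a n
      simp only [Matrix.of_apply, Matrix.add_apply, Matrix.smul_apply, smul_eq_mul,
        Matrix.mul_apply, hV, Matrix.transpose_apply, Matrix.vandermonde_apply]
      rw [h a, Finset.sum_range]
      have : ∀ t : Fin N, c a t * (x * z n) ^ (t : ℕ) = x ^ (t : ℕ) * c a t * z n ^ (t : ℕ) :=
        fun t => by ring
      simp only [this]
      ring
    rw [key, Matrix.det_mul, Matrix.det_mul_row, Finset.prod_pow_eq_pow_sum, mul_assoc]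

/-- Schwarz's lemma for interpolation determinants. -/
lemma norm_det_interpolation_le {N : ℕ} {f : Fin N → ℂ → ℂ} (hf : ∀ a, Differentiable ℂ (f a))
    {z : Fin N → ℂ} (hz : Function.Injective z) {e : Fin N → Fin N → ℂ} {ρ Y : ℝ} (hρ : 1 ≤ ρ)
    (hY : ∀ n, ‖z n‖ ≤ Y) {M : Fin N → ℝ} (hM : ∀ a w, ‖w‖ ≤ ρ * Y → ‖f a w‖ ≤ M a)
    (he : ∀ a n, ρ ^ N * ‖e a n‖ ≤ M a) :
    ρ ^ (N * (N - 1) / 2) * ‖(Matrix.of fun a n => f a (z n) + e a n).det‖ ≤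
      N.factorial * ∏ a, (2 * M a) := by
  obtain ⟨H, hH, hdet⟩ := exists_det_eq_pow_mul hf hz e
  have hsum : ∑ t : Fin N, (t : ℕ) = N * (N - 1) / 2 := by
    rw [← Finset.sum_range (fun t => t), Finset.sum_range_id]
  rw [hsum] at hdet
  have h1 : (Matrix.of fun a n => f a (z n) + e a n).det = H 1 := by
    simpa using hdet 1
  have hρ0 : 0 < ρ := by linarith
  rw [h1, mul_comm, ← le_div_iff₀ (by positivity)]
  refine Complex.norm_le_of_forall_mem_frontier_norm_le (U := Metric.ball (0 : ℂ) ρ)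
    Metric.isBounded_ball hH.diffContOnCl ?_ ?_
  · intro x hx
    rw [frontier_ball _ hρ0.ne', mem_sphere_zero_iff_norm] at hx
    rw [le_div_iff₀ (by positivity), mul_comm]
    have h2 : ρ ^ (N * (N - 1) / 2) * ‖H x‖ =
        ‖(Matrix.of fun a n => f a (x * z n) + x ^ N * e a n).det‖ := by
      rw [hdet, norm_mul, norm_pow, hx]
    rw [h2]
    refine norm_det_le_of_row_bound _ _ fun a n => ?_
    refine (norm_add_le _ _).trans ?_
    have h3 : ‖f a (x * z n)‖ ≤ M a := by
      apply hM
      rw [norm_mul, hx]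
      exact mul_le_mul_of_nonneg_left (hY n) hρ0.le
    have h4 : ‖x ^ N * e a n‖ ≤ M a := by
      rw [norm_mul, norm_pow, hx]
      exact he a n
    linarith
  · rw [closure_ball _ hρ0.ne']
    simpa using hρ

open Polynomial in
/-- A zero estimate for exponential polynomials: a nontrivial one has few blocks of consecutive
zeros. -/
lemma false_of_many_zeros {n K : ℕ} (hn : 0 < n) {a : Fin n → ℝ[X]} (ha : ∀ l, a l ≠ 0)
    (hdeg : ∀ l, (a l).natDegree < K) {c : Fin n → ℝ} (hc : Function.Injective c) {T : Finset ℝ}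
    (hT : n * K ≤ T.card) (hzero : ∀ y ∈ T, ∃ w : Fin n → ℝ, w ≠ 0 ∧
      ∀ s : Fin n, ∑ l, (a l).eval (y + (s : ℕ)) * c l ^ (s : ℕ) * w l = 0) : False := by
  set A : Matrix (Fin n) (Fin n) ℝ[X] := Matrix.of fun s l =>
    X ^ (K - 1 - (a l).natDegree) * (taylor ((s : ℕ) : ℝ) (a l) * C (c l ^ (s : ℕ))) with hA
  have hAdeg : ∀ s l, (A s l).natDegree ≤ K - 1 := by
    intro s l
    have h1 := hdeg l
    have h2 : (taylor ((s : ℕ) : ℝ) (a l) * C (c l ^ (s : ℕ))).natDegree ≤ (a l).natDegree := by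
      refine natDegree_mul_le.trans ?_
      rw [natDegree_taylor, natDegree_C, add_zero]
    have h3 := natDegree_mul_le (p := (X : ℝ[X]) ^ (K - 1 - (a l).natDegree))
      (q := taylor ((s : ℕ) : ℝ) (a l) * C (c l ^ (s : ℕ)))
    rw [natDegree_X_pow] at h3
    simp only [hA, Matrix.of_apply]
    omega
  have hAcoeff : ∀ s l, (A s l).coeff (K - 1) = (a l).leadingCoeff * c l ^ (s : ℕ) := by
    intro s l
    have h1 := hdeg l
    simp only [hA, Matrix.of_apply]
    have : K - 1 = (a l).natDegree + (K - 1 - (a l).natDegree) := by omega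
    conv_lhs => rw [this]
    rw [Nat.add_sub_cancel_left, coeff_X_pow_mul, coeff_mul_C, coeff_taylor_natDegree]
  have hdetdeg : A.det.natDegree ≤ n * (K - 1) := by
    rw [Matrix.det_apply']
    refine natDegree_sum_le_of_forall_le _ _ fun σ _ => ?_
    refine natDegree_mul_le.trans ?_
    rw [natDegree_intCast, zero_add]
    refine (natDegree_prod_le _ _).trans ?_
    refine (Finset.sum_le_sum fun i _ => hAdeg (σ i) i).trans ?_
    simp
  have hdetcoeff : A.det.coeff (n * (K - 1)) ≠ 0 := by
    have h1 : A.det.coeff (n * (K - 1)) =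
        (Matrix.of fun s l : Fin n => (a l).leadingCoeff * c l ^ (s : ℕ)).det := by
      rw [Matrix.det_apply', Matrix.det_apply', finsetSum_coeff]
      refine Finset.sum_congr rfl fun σ _ => ?_
      rw [coeff_intCast_mul]
      congr 1
      have h2 := coeff_prod_of_natDegree_le (s := Finset.univ) (fun i => A (σ i) i) (K - 1)
        fun i _ => hAdeg _ _
      rw [Finset.card_univ, Fintype.card_fin] at h2
      rw [h2]
      exact Finset.prod_congr rfl fun i _ => hAcoeff _ _
    have h3 := Matrix.det_mul_row (fun l => (a l).leadingCoeff) (Matrix.vandermonde c).transpose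
    simp only [Matrix.transpose_apply, Matrix.vandermonde_apply] at h3
    rw [h1, h3, Matrix.det_transpose]
    refine mul_ne_zero (Finset.prod_ne_zero_iff.mpr fun l _ => leadingCoeff_ne_zero.mpr (ha l)) ?_
    exact Matrix.det_vandermonde_ne_zero_iff.mpr hc
  refine hdetcoeff ?_
  rw [eq_zero_of_natDegree_lt_card_of_eval_eq_zero' A.det T ?_ ?_, coeff_zero]
  · intro y hy
    obtain ⟨w, hw, hsum⟩ := hzero y hy
    have h1 : A.det.eval y = (A.map (eval y)).det := by
      rw [← coe_evalRingHom, RingHom.map_det]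
      rfl
    have h2 : A.map (eval y) = Matrix.of fun s l => y ^ (K - 1 - (a l).natDegree) *
        (Matrix.of fun s l : Fin n => (a l).eval (y + (s : ℕ)) * c l ^ (s : ℕ)) s l := by
      ext s l
      simp [hA, taylor_eval]
    rw [h1, h2, Matrix.det_mul_row, Matrix.exists_mulVec_eq_zero_iff.mp, mul_zero]
    exact ⟨w, hw, funext fun s => by simpa [Matrix.mulVec, dotProduct] using hsum s⟩
  · have hK : 0 < K := (Nat.zero_le _).trans_lt (hdeg ⟨0, hn⟩)
    refine hdetdeg.trans_lt (lt_of_lt_of_le ?_ hT)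
    exact Nat.mul_lt_mul_of_pos_left (by omega) hn

open Polynomial in
/-- The polynomial taking the value `∑ k, v k * y.choose k` at a natural number `y`. -/
noncomputable def binomialSum {K : ℕ} (v : Fin K → ℝ) : ℝ[X] :=
  ∑ k : Fin K, C (v k / (k : ℕ).factorial) * descPochhammer ℝ k

open Polynomial in
lemma binomialSum_eval {K : ℕ} (v : Fin K → ℝ) (y : ℕ) :
    (binomialSum v).eval (y : ℝ) = ∑ k : Fin K, v k * (y.choose k : ℝ) := by
  rw [binomialSum, eval_finsetSum]
  refine Finset.sum_congr rfl fun k _ => ?_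
  rw [eval_mul, eval_C, descPochhammer_eval_eq_descFactorial,
    Nat.descFactorial_eq_factorial_mul_choose]
  have : ((k : ℕ).factorial : ℝ) ≠ 0 := by positivity
  push_cast
  field_simp

open Polynomial in
lemma binomialSum_natDegree_lt {K : ℕ} (hK : 0 < K) (v : Fin K → ℝ) :
    (binomialSum v).natDegree < K := by
  have : (binomialSum v).natDegree ≤ K - 1 := by
    refine natDegree_sum_le_of_forall_le _ _ fun k _ => ?_
    refine natDegree_mul_le.trans ?_
    rw [natDegree_C, zero_add, descPochhammer_natDegree]
    omega
  omega

lemma eq_zero_of_binomialSum_eq_zero {K : ℕ} {v : Fin K → ℝ} (h : binomialSum v = 0) : v = 0 := by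
  have key : ∀ n : ℕ, ∀ hn : n < K, v ⟨n, hn⟩ = 0 := by
    intro n
    induction n using Nat.strong_induction_on with
    | _ n ih =>
      intro hn
      have h1 := binomialSum_eval v n
      rw [h, Polynomial.eval_zero, Finset.sum_eq_single ⟨n, hn⟩] at h1
      · simpa using h1.symm
      · intro k _ hk
        rcases lt_or_gt_of_ne (fun hkn => hk (Fin.ext hkn) : (k : ℕ) ≠ n) with hlt | hgt
        · rw [ih k hlt k.2, zero_mul]
        · rw [Nat.choose_eq_zero_of_lt hgt, Nat.cast_zero, mul_zero]
      · simp
  exact funext fun k => key k k.2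

/-- The value at `ℓ * i + j` of the function `y ↦ y.choose k * θ ^ (y * l)`, for `l` in
`{-1, 0, 1}`, with `θ ^ ℓ` replaced by `β` and `θ ^ j` by `α ^ j`. -/
noncomputable def interpolationEntry (ℓ : ℕ) (β α : ℝ) (a : ℕ × Fin 3) (p : ℕ × ℕ) : ℝ :=
  ((ℓ * p.1 + p.2).choose a.1 : ℝ) * (β ^ p.1 * α ^ p.2) ^ (((a.2 : ℕ) : ℤ) - 1)

lemma rows_independent {ℓ K R S : ℕ} (hS : S ≤ ℓ) {β α : ℝ} (hβ : 0 < β) (hα : 1 < α)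
    (hcard : 3 * K ≤ R * S) {v : Fin K × Fin 3 → ℝ}
    (h : ∀ i < R, ∀ j < S + 2,
      ∑ a, v a * interpolationEntry ℓ β α ((a.1 : ℕ), a.2) (i, j) = 0) : v = 0 := by
  have hα0 : 0 < α := by linarith
  set b : Fin 3 → Polynomial ℝ := fun l => binomialSum fun k => v (k, l) with hb
  suffices hall : ∀ l, b l = 0 by
    funext ⟨k, l⟩
    exact congrFun (eq_zero_of_binomialSum_eq_zero (hall l)) k
  by_contra hne
  push Not at hne
  obtain ⟨l₀, hl₀⟩ := hne
  have hK : 0 < K := by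
    by_contra hK
    obtain rfl : K = 0 := by omega
    exact hl₀ (by simp [hb, binomialSum])
  classical
  set s : Finset (Fin 3) := Finset.univ.filter fun l => b l ≠ 0 with hs
  let e := s.equivFin.symm
  have hs3 : s.card ≤ 3 := by simpa using Finset.card_le_univ s
  have hrel : ∀ i < R, ∀ j < S + 2, ∑ l : Fin s.card, (b (e l)).eval ((ℓ * i + j : ℕ) : ℝ) *
      (β ^ i * α ^ j) ^ (((e l : Fin 3) : ℕ) - 1 : ℤ) = 0 := by
    intro i hi j hj
    have h1 := h i hi j hj
    rw [Fintype.sum_prod_type_right] at h1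
    rw [Equiv.sum_comp e (fun l : s => (b l).eval ((ℓ * i + j : ℕ) : ℝ) *
      (β ^ i * α ^ j) ^ (((l : Fin 3) : ℕ) - 1 : ℤ)), Finset.sum_coe_sort s
      (fun l => (b l).eval ((ℓ * i + j : ℕ) : ℝ) * (β ^ i * α ^ j) ^ ((l : ℕ) - 1 : ℤ)),
      hs, Finset.sum_filter_of_ne, ← h1]
    · refine Finset.sum_congr rfl fun l _ => ?_
      rw [hb, binomialSum_eval, Finset.sum_mul]
      refine Finset.sum_congr rfl fun k _ => ?_
      rw [interpolationEntry, mul_assoc]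
    · intro l _ hl h0
      rw [h0] at hl
      simp at hl
  set T : Finset ℝ := (Finset.range R ×ˢ Finset.range S).image
    fun p => ((ℓ * p.1 + p.2 : ℕ) : ℝ) with hT
  have hTcard : T.card = R * S := by
    rw [hT, Finset.card_image_of_injOn, Finset.card_product, Finset.card_range, Finset.card_range]
    rintro ⟨i, j⟩ hp ⟨i', j'⟩ hp' heq
    simp only [Finset.coe_product, Finset.coe_range, Set.mem_prod, Set.mem_Iio] at hp hp'
    have heq' : ℓ * i + j = ℓ * i' + j' := Nat.cast_injective (R := ℝ) heq
    have h1 : i = i' := by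
      have := congrArg (· / ℓ) heq'
      simpa [Nat.mul_add_div (by omega : 0 < ℓ), Nat.div_eq_of_lt (by omega : j < ℓ),
        Nat.div_eq_of_lt (by omega : j' < ℓ)] using this
    subst h1
    simpa using heq'
  refine false_of_many_zeros (n := s.card) (K := K) (a := fun l => b (e l))
    (c := fun l => α ^ (((e l : Fin 3) : ℕ) - 1 : ℤ)) (T := T) ?_ ?_ ?_ ?_ ?_ ?_
  · exact Finset.card_pos.mpr ⟨l₀, by simp [hs, hl₀]⟩
  · exact fun l => (Finset.mem_filter.mp (e l).2).2
  · exact fun l => binomialSum_natDegree_lt hK _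
  · intro l l' hll
    have h1 := zpow_right_injective₀ hα0 hα.ne' hll
    have h2 : ((e l : Fin 3) : ℕ) = (e l' : Fin 3) := by omega
    exact e.injective (Subtype.ext (Fin.ext h2))
  · rw [hTcard]
    exact (Nat.mul_le_mul_right K hs3).trans hcard
  · intro y hy
    rw [hT, Finset.mem_image] at hy
    obtain ⟨⟨i, j⟩, hp, rfl⟩ := hy
    rw [Finset.mem_product, Finset.mem_range, Finset.mem_range] at hp
    refine ⟨fun l => (β ^ i * α ^ j) ^ (((e l : Fin 3) : ℕ) - 1 : ℤ), ?_, fun t => ?_⟩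
    · intro h0
      have := congrFun h0 ⟨0, Finset.card_pos.mpr ⟨l₀, by simp [hs, hl₀]⟩⟩
      have hpos : 0 < β ^ i * α ^ j := by positivity
      exact (zpow_pos hpos _).ne' this
    · rw [← hrel i hp.1 (j + t) (by have := t.2; have := hp.2; omega)]
      refine Finset.sum_congr rfl fun l _ => ?_
      rw [pow_add, ← mul_assoc (β ^ i), mul_zpow _ (α ^ (t : ℕ)), ← zpow_natCast (α ^ _) (t : ℕ),
        ← zpow_natCast α (t : ℕ), zpow_comm]
      push_cast
      ring_nf

/-- An integer clearing the denominators of a row of the interpolation matrix. -/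
def rowScale (β X B R S : ℕ) (l : Fin 3) : ℕ :=
  ![β ^ (R - 1) * X ^ (S - 1), 1, B ^ (S - 1)] l

lemma exists_int_entry {ℓ β X B R S : ℕ} (hβ : 0 < β) (hX : 0 < X) (hB : 0 < B) (a : ℕ × Fin 3)
    {p : ℕ × ℕ} (hi : p.1 < R) (hj : p.2 < S) :
    ∃ g : ℤ, (g : ℝ) = rowScale β X B R S a.2 * interpolationEntry ℓ β (X / B) a p := by
  obtain ⟨k, l⟩ := a
  obtain ⟨i, j⟩ := p
  have hβ' : (β : ℝ) ≠ 0 := by positivity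
  have hX' : (X : ℝ) ≠ 0 := by positivity
  have hB' : (B : ℝ) ≠ 0 := by positivity
  obtain ⟨i', rfl⟩ := Nat.exists_eq_add_of_lt hi
  obtain ⟨j', rfl⟩ := Nat.exists_eq_add_of_lt hj
  fin_cases l
  · refine ⟨(ℓ * i + j).choose k * (β ^ i' * X ^ j' * B ^ j), ?_⟩
    simp only [rowScale, interpolationEntry]
    push_cast
    simp
    rw [div_pow, pow_add, pow_add]
    field_simp
  · exact ⟨(ℓ * i + j).choose k, by simp [rowScale, interpolationEntry]⟩
  · refine ⟨(ℓ * i + j).choose k * (β ^ i * X ^ j * B ^ j'), ?_⟩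
    simp only [rowScale, interpolationEntry]
    push_cast
    simp
    rw [div_pow, pow_add]
    field_simp

lemma one_le_scaled_det {N ℓ β X B R S : ℕ} (hβ : 0 < β) (hX : 0 < X) (hB : 0 < B)
    (row : Fin N → ℕ × Fin 3) {col : Fin N → ℕ × ℕ} (hcol : ∀ n, (col n).1 < R ∧ (col n).2 < S)
    (hdet : (Matrix.of fun a n => interpolationEntry ℓ β (X / B) (row a) (col n)).det ≠ 0) :
    1 ≤ (∏ a, (rowScale β X B R S (row a).2 : ℝ)) *
      |(Matrix.of fun a n => interpolationEntry ℓ β (X / B) (row a) (col n)).det| := by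
  choose g hg using fun a n => exists_int_entry (ℓ := ℓ) hβ hX hB (row a) (hcol n).1 (hcol n).2
  have h1 := Matrix.det_mul_column (fun a => (rowScale β X B R S (row a).2 : ℝ))
    (Matrix.of fun a n => interpolationEntry ℓ β (X / B) (row a) (col n))
  have h2 : (Matrix.of fun a n => (rowScale β X B R S (row a).2 : ℝ) *
      (Matrix.of fun a n => interpolationEntry ℓ β (X / B) (row a) (col n)) a n).det =
      ((Matrix.of g).det : ℝ) := by
    rw [Int.cast_det]
    congr 1
    ext a n
    simp [hg]
  have hpos : 0 < ∏ a, (rowScale β X B R S (row a).2 : ℝ) := by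
    refine Finset.prod_pos fun a _ => ?_
    have : ∀ l, 0 < rowScale β X B R S l := by
      intro l
      fin_cases l <;> simp [rowScale, hβ, hX, hB]
    exact_mod_cast this _
  rw [← abs_of_pos hpos, ← abs_mul, ← h1, h2]
  have hne : (Matrix.of g).det ≠ 0 := by
    intro h0
    rw [h2, h0, Int.cast_zero] at h1
    exact (mul_ne_zero hpos.ne' hdet) h1.symm
  exact_mod_cast Int.one_le_abs hne

/-- The function `z ↦ (z + Y).choose k * exp (l * μ * z)`. -/
noncomputable def interpolationFun (μ Y : ℝ) (k : ℕ) (l : ℤ) (z : ℂ) : ℂ :=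
  (∏ i ∈ Finset.range k, (z + Y - i)) / k.factorial * Complex.exp (l * μ * z)

lemma differentiable_interpolationFun (μ Y : ℝ) (k : ℕ) (l : ℤ) :
    Differentiable ℂ (interpolationFun μ Y k l) := by
  unfold interpolationFun
  fun_prop

lemma interpolationFun_natCast_sub (μ Y : ℝ) (k : ℕ) (l : ℤ) (y : ℕ) :
    interpolationFun μ Y k l ((y - Y : ℝ) : ℂ) =
      ((y.choose k * Real.exp (l * μ * (y - Y)) : ℝ) : ℂ) := by
  have h1 : ∏ i ∈ Finset.range k, (((y : ℝ) - Y : ℝ) + Y - i : ℂ) = y.descFactorial k := by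
    rw [← descPochhammer_eval_eq_descFactorial ℂ, descPochhammer_eval_eq_prod_range]
    exact Finset.prod_congr rfl fun i _ => by push_cast; ring
  rw [interpolationFun, h1, Nat.descFactorial_eq_factorial_mul_choose]
  have : (k.factorial : ℂ) ≠ 0 := by exact_mod_cast k.factorial_ne_zero
  push_cast
  field_simp

lemma norm_interpolationFun_le {μ Y ρ : ℝ} (hμ : 0 ≤ μ) (hY : 0 ≤ Y) (hρ : 0 ≤ ρ) {k : ℕ}
    (hk : (k : ℝ) ≤ 2 * Y) (l : ℤ) {w : ℂ} (hw : ‖w‖ ≤ ρ * Y) :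
    ‖interpolationFun μ Y k l w‖ ≤
      ((ρ + 1) * Y) ^ k / k.factorial * Real.exp (|(l : ℝ)| * μ * (ρ * Y)) := by
  rw [interpolationFun, norm_mul, norm_div, norm_prod, Complex.norm_natCast, Complex.norm_exp]
  have h1 : ∏ i ∈ Finset.range k, ‖w + Y - i‖ ≤ ((ρ + 1) * Y) ^ k := by
    conv_rhs => rw [← Finset.card_range k, ← Finset.prod_const]
    refine Finset.prod_le_prod (fun i _ => norm_nonneg _) fun i hi => ?_
    have hi' : (i : ℝ) ≤ 2 * Y :=
      le_trans (by exact_mod_cast (Finset.mem_range.mp hi).le) hk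
    have h2 : ‖(Y - i : ℂ)‖ ≤ Y := by
      rw [show (Y - i : ℂ) = ((Y - i : ℝ) : ℂ) by push_cast; ring, Complex.norm_real,
        Real.norm_eq_abs, abs_le]
      have : (0 : ℝ) ≤ i := by positivity
      constructor <;> linarith
    calc ‖w + Y - i‖ = ‖w + (Y - i)‖ := by rw [add_sub_assoc]
      _ ≤ ‖w‖ + ‖(Y - i : ℂ)‖ := norm_add_le _ _
      _ ≤ (ρ + 1) * Y := by linarith
  have h3 : (l * μ * w : ℂ).re ≤ |(l : ℝ)| * μ * (ρ * Y) := by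
    refine (Complex.re_le_norm _).trans ?_
    rw [norm_mul, norm_mul, Complex.norm_real, Real.norm_eq_abs, abs_of_nonneg hμ,
      Complex.norm_intCast]
    gcongr
  gcongr

lemma interpolationEntry_eq {ℓ : ℕ} {β α μ κ : ℝ} (hβ : β = Real.exp (ℓ * μ))
    (hα : α = Real.exp (μ - κ)) (Y : ℝ) (a : ℕ × Fin 3) (p : ℕ × ℕ) :
    Real.exp (-((((a.2 : ℕ) : ℤ) - 1 : ℤ) * μ * Y)) * interpolationEntry ℓ β α a p =
      ((ℓ * p.1 + p.2).choose a.1 : ℝ) *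
        Real.exp ((((a.2 : ℕ) : ℤ) - 1 : ℤ) * μ * ((ℓ * p.1 + p.2 : ℕ) - Y)) *
        Real.exp (-((((a.2 : ℕ) : ℤ) - 1 : ℤ) * κ * p.2)) := by
  rw [interpolationEntry, hβ, hα, ← Real.exp_nat_mul, ← Real.exp_nat_mul, ← Real.exp_add,
    ← Real.rpow_intCast, ← Real.exp_mul, mul_left_comm, ← Real.exp_add,
    mul_assoc _ (Real.exp _) (Real.exp _), ← Real.exp_add]
  congr 2
  push_cast
  ring

lemma det_interpolation_upper {K ℓ S : ℕ} (row : Fin (K * 3) ≃ Fin K × Fin 3)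
    {col : Fin (K * 3) → ℕ × ℕ} (hinj : Function.Injective fun n => ℓ * (col n).1 + (col n).2)
    {β α μ κ Y ρ : ℝ} (hβ : β = Real.exp (ℓ * μ)) (hα : α = Real.exp (μ - κ)) (hμ : 0 ≤ μ)
    (hκ : 0 ≤ κ) (hρ : 1 ≤ ρ) (hKY : (K : ℝ) ≤ 2 * Y)
    (hcolS : ∀ n, (col n).2 ≤ S) (hcolY : ∀ n, ((ℓ * (col n).1 + (col n).2 : ℕ) : ℝ) ≤ 2 * Y)
    (hsmall : ρ ^ (K * 3) * (2 * (κ * S)) ≤ 1) :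
    ρ ^ (K * 3 * (K * 3 - 1) / 2) * |(Matrix.of fun a n => interpolationEntry ℓ β α
        (((row a).1 : ℕ), (row a).2) (col n)).det| ≤
      (K * 3).factorial * ∏ a : Fin K × Fin 3, (2 * (((ρ + 1) * Y) ^ (a.1 : ℕ) /
        (a.1 : ℕ).factorial *
          Real.exp (|((((a.2 : ℕ) : ℤ) - 1 : ℤ) : ℝ)| * μ * (ρ * Y)))) := by
  have hY : 0 ≤ Y := by have : (0 : ℝ) ≤ K := by positivity
                        linarith
  set y : Fin (K * 3) → ℕ := fun n => ℓ * (col n).1 + (col n).2 with hy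
  set l : Fin (K * 3) → ℤ := fun a => (((row a).2 : ℕ) : ℤ) - 1 with hl
  have hl1 : ∀ a, |(l a : ℝ)| ≤ 1 := by
    intro a
    have := (row a).2.2
    have : |l a| ≤ 1 := by rw [abs_le]; simp only [hl]; omega
    exact_mod_cast this
  set f : Fin (K * 3) → ℂ → ℂ := fun a => interpolationFun μ Y (row a).1 (l a) with hf
  set z : Fin (K * 3) → ℂ := fun n => ((y n - Y : ℝ) : ℂ) with hz
  set e : Fin (K * 3) → Fin (K * 3) → ℂ := fun a n =>
    f a (z n) * ((Real.exp (-(l a * κ * (col n).2)) - 1 : ℝ) : ℂ) with he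
  set M : Fin (K * 3) → ℝ := fun a => ((ρ + 1) * Y) ^ ((row a).1 : ℕ) /
    ((row a).1 : ℕ).factorial * Real.exp (|(l a : ℝ)| * μ * (ρ * Y)) with hM
  have hzY : ∀ n, ‖z n‖ ≤ Y := by
    intro n
    rw [hz, Complex.norm_real, Real.norm_eq_abs, abs_le]
    have h1 := hcolY n
    have h2 : (0 : ℝ) ≤ y n := by positivity
    constructor <;> linarith
  have hfM : ∀ a w, ‖w‖ ≤ ρ * Y → ‖f a w‖ ≤ M a := by
    intro a w hw
    refine norm_interpolationFun_le hμ hY (by linarith) (le_trans ?_ hKY) _ hw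
    exact_mod_cast (row a).1.2.le
  have hM0 : ∀ a, 0 ≤ M a := by intro a; positivity
  have heM : ∀ a n, ρ ^ (K * 3) * ‖e a n‖ ≤ M a := by
    intro a n
    have h1 : ‖f a (z n)‖ ≤ M a := hfM a _ ((hzY n).trans (le_mul_of_one_le_left hY hρ))
    have hκS : |-(l a * κ * (col n).2)| ≤ κ * S := by
      rw [abs_neg, abs_mul, abs_mul, abs_of_nonneg hκ, Nat.abs_cast]
      have : ((col n).2 : ℝ) ≤ S := by exact_mod_cast hcolS n
      calc |(l a : ℝ)| * κ * (col n).2 ≤ 1 * κ * S := by gcongr; exact hl1 a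
        _ = κ * S := by ring
    have hρN : (1 : ℝ) ≤ ρ ^ (K * 3) := one_le_pow₀ hρ
    have hκS1 : κ * S ≤ 1 := by nlinarith [mul_nonneg hκ (Nat.cast_nonneg (α := ℝ) S)]
    have h2 := Real.abs_exp_sub_one_le (hκS.trans hκS1)
    rw [he, norm_mul, Complex.norm_real, Real.norm_eq_abs]
    calc ρ ^ (K * 3) * (‖f a (z n)‖ * |Real.exp (-(l a * κ * (col n).2)) - 1|)
        ≤ ρ ^ (K * 3) * (M a * (2 * (κ * S))) := by
          gcongr
          linarith
      _ = M a * (ρ ^ (K * 3) * (2 * (κ * S))) := by ring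
      _ ≤ M a := mul_le_of_le_one_right (hM0 a) hsmall
  have hzinj : Function.Injective z := by
    intro n n' h
    have h1 : (y n : ℝ) - Y = y n' - Y := Complex.ofReal_injective h
    have h2 : (y n : ℝ) = y n' := by linarith
    exact hinj (by exact_mod_cast h2)
  have key := norm_det_interpolation_le (fun a => differentiable_interpolationFun μ Y _ (l a))
    hzinj hρ hzY hfM heM
  have hdet : (Matrix.of fun a n => f a (z n) + e a n).det =
      ((Matrix.of fun a n => interpolationEntry ℓ β α
        (((row a).1 : ℕ), (row a).2) (col n)).det : ℂ) := by
    have h1 := Matrix.det_mul_column (fun a => Real.exp (-(l a * μ * Y)))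
      (Matrix.of fun a n => interpolationEntry ℓ β α (((row a).1 : ℕ), (row a).2) (col n))
    have h2 : ∏ a, Real.exp (-(l a * μ * Y)) = 1 := by
      rw [← Real.exp_sum, Real.exp_eq_one_iff, ← Equiv.sum_comp row.symm, Fintype.sum_prod_type]
      simp [hl, Fin.sum_univ_three]
      ring
    rw [h2, one_mul] at h1
    rw [← h1, ← Complex.ofRealHom_eq_coe, RingHom.map_det]
    congr 1
    ext a n
    simp only [Matrix.of_apply, RingHom.mapMatrix_apply, Matrix.map_apply,
      Complex.ofRealHom_eq_coe]
    have h3 := interpolationEntry_eq hβ hα Y (((row a).1 : ℕ), (row a).2) (col n)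
    have h4 : f a (z n) = _ := interpolationFun_natCast_sub μ Y (row a).1 (l a) (y n)
    rw [show Real.exp (-(l a * μ * Y)) * interpolationEntry ℓ β α _ _ =
      (y n).choose (row a).1 * Real.exp (l a * μ * (y n - Y)) *
        Real.exp (-(l a * κ * (col n).2)) from h3]
    simp only [he, h4]
    push_cast
    ring
  rw [hdet, Complex.norm_real, Real.norm_eq_abs] at key
  rw [← Equiv.prod_comp row]
  exact key

lemma prod_interpolation_bound (K : ℕ) (A C : ℝ) :
    ∏ a : Fin K × Fin 3, (2 * (A ^ (a.1 : ℕ) / (a.1 : ℕ).factorial *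
        Real.exp (|((((a.2 : ℕ) : ℤ) - 1 : ℤ) : ℝ)| * C))) =
      2 ^ (K * 3) * (∏ k ∈ Finset.range K, A ^ k / k.factorial) ^ 3 * Real.exp (2 * K * C) := by
  rw [Fintype.prod_prod_type]
  have h (k : Fin K) : ∏ l : Fin 3, (2 * (A ^ (k : ℕ) / (k : ℕ).factorial *
      Real.exp (|((((l : ℕ) : ℤ) - 1 : ℤ) : ℝ)| * C))) =
      2 ^ 3 * (A ^ (k : ℕ) / (k : ℕ).factorial) ^ 3 * Real.exp (2 * C) := by
    rw [Fin.prod_univ_three, two_mul C, Real.exp_add]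
    norm_num
    ring
  simp only [h]
  rw [Finset.prod_mul_distrib, Finset.prod_mul_distrib, Finset.prod_pow _ 3, Finset.prod_const,
    Finset.card_univ, Fintype.card_fin, Finset.prod_pow _ 3 (fun k : Fin K => _),
    Fin.prod_univ_eq_prod_range (fun k => A ^ k / (k.factorial : ℝ)) K, Finset.prod_const,
    Finset.card_univ, Fintype.card_fin, ← Real.exp_nat_mul, ← pow_mul]
  ring_nf

lemma prod_rowScale (K β X B R S : ℕ) :
    ∏ a : Fin K × Fin 3, (rowScale β X B R S a.2 : ℝ) =
      ((β : ℝ) ^ (R - 1) * X ^ (S - 1) * B ^ (S - 1)) ^ K := by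
  rw [Fintype.prod_prod_type]
  simp [Fin.prod_univ_three, rowScale]

/-- The upper and lower bounds for a nonzero interpolation determinant, combined. -/
lemma interpolation_inequality {ℓ K R S β X B : ℕ} (hS : S + 2 ≤ ℓ) (hcard : 3 * K ≤ R * S)
    (hβ0 : 0 < β) (hB : 0 < B) (hXB : B < X) {μ κ ρ Y : ℝ}
    (hβ : (β : ℝ) = Real.exp (ℓ * μ)) (hα : (X / B : ℝ) = Real.exp (μ - κ)) (hμ : 0 ≤ μ)
    (hκ : 0 ≤ κ) (hρ : 1 ≤ ρ) (hKY : (K : ℝ) ≤ 2 * Y) (hY : ((ℓ * R : ℕ) : ℝ) ≤ 2 * Y)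
    (hsmall : ρ ^ (K * 3) * (2 * (κ * ((S + 2 : ℕ) : ℝ))) ≤ 1) :
    ρ ^ (K * 3 * (K * 3 - 1) / 2) ≤
      ((β : ℝ) ^ (R - 1) * X ^ (S + 1) * B ^ (S + 1)) ^ K * ((K * 3).factorial *
        (2 ^ (K * 3) * (∏ k ∈ Finset.range K, ((ρ + 1) * Y) ^ k / k.factorial) ^ 3 *
          Real.exp (2 * K * (μ * (ρ * Y))))) := by
  set row : Fin (K * 3) ≃ Fin K × Fin 3 := finProdFinEquiv.symm with hrow
  have hβR : (0 : ℝ) < β := by exact_mod_cast hβ0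
  have hBR : (0 : ℝ) < B := by exact_mod_cast hB
  have hα1 : (1 : ℝ) < X / B := by
    rw [lt_div_iff₀ hBR, one_mul]
    exact_mod_cast hXB
  obtain ⟨col, hcol, hdet⟩ := exists_submatrix_det_ne_zero
    (fun a (p : Fin R × Fin (S + 2)) => interpolationEntry ℓ β (X / B)
      (((row a).1 : ℕ), (row a).2) ((p.1 : ℕ), (p.2 : ℕ))) (by
    intro v hv
    have := rows_independent (ℓ := ℓ) (K := K) (R := R) (S := S) (by omega) hβR hα1 hcard
      (v := v ∘ row.symm) (by
      intro i hi j hj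
      rw [← hv (⟨i, hi⟩, ⟨j, hj⟩), ← Equiv.sum_comp row]
      simp)
    ext a
    simpa using congrFun this (row a))
  set col' : Fin (K * 3) → ℕ × ℕ := fun n => (((col n).1 : ℕ), ((col n).2 : ℕ)) with hcol'
  have hc1 : ∀ n, (col' n).1 < R := fun n => (col n).1.2
  have hc2 : ∀ n, (col' n).2 < S + 2 := fun n => (col n).2.2
  have hinj : Function.Injective fun n => ℓ * (col' n).1 + (col' n).2 := by
    intro n n' h
    have h1 := (hc2 n).trans_le hS
    have h2 := (hc2 n').trans_le hS
    have hℓ : 0 < ℓ := by omega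
    have hi : (col' n).1 = (col' n').1 := by
      have := congrArg (· / ℓ) h
      simpa [Nat.mul_add_div hℓ, Nat.div_eq_of_lt h1, Nat.div_eq_of_lt h2] using this
    have hj : (col' n).2 = (col' n').2 := by
      have := congrArg (· % ℓ) h
      simpa [Nat.mul_add_mod, Nat.mod_eq_of_lt h1, Nat.mod_eq_of_lt h2] using this
    exact hcol (Prod.ext (Fin.ext hi) (Fin.ext hj))
  have hup := det_interpolation_upper (S := S + 2) row hinj hβ hα hμ hκ hρ hKY
    (fun n => (hc2 n).le) (fun n => by
      refine le_trans ?_ hY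
      have h1 := hc1 n
      have h2 := (hc2 n).trans_le hS
      have : ℓ * (col' n).1 + (col' n).2 ≤ ℓ * R := by
        calc ℓ * (col' n).1 + (col' n).2 ≤ ℓ * ((col' n).1 + 1) := by
              rw [mul_add, mul_one]; omega
          _ ≤ ℓ * R := Nat.mul_le_mul_left _ h1
      exact_mod_cast this) hsmall
  have hlow := one_le_scaled_det (R := R) (S := S + 2) hβ0 (hB.trans hXB) hB
    (fun a => (((row a).1 : ℕ), (row a).2)) (fun n => ⟨hc1 n, hc2 n⟩) hdet
  rw [Equiv.prod_comp row (fun a : Fin K × Fin 3 => (rowScale β X B R (S + 2) a.2 : ℝ)),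
    prod_rowScale, show S + 2 - 1 = S + 1 from rfl] at hlow
  simp only [mul_assoc _ μ] at hup
  rw [prod_interpolation_bound] at hup
  refine (le_mul_of_one_le_right (by positivity) hlow).trans ?_
  rw [mul_left_comm]
  gcongr

open Real in
lemma exp_le_prod_factorial {K : ℕ} (hK : 1 ≤ K) :
    exp ((K : ℝ) * (K - 1) / 2 * (log K - 3 / 2)) ≤ ∏ k ∈ Finset.range K, (k.factorial : ℝ) := by
  induction K, hK using Nat.le_induction with
  | base => simp
  | succ K hK ih =>
    have hK1 : (1 : ℝ) ≤ K := by exact_mod_cast hK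
    have hK0 : (0 : ℝ) < K := by linarith
    have hlog : log ((K + 1 : ℕ) : ℝ) ≤ log K + 1 / K := by
      have h1 : ((K + 1 : ℕ) : ℝ) = K * (1 + 1 / K) := by push_cast; field_simp
      have h2 := log_le_sub_one_of_pos (show (0 : ℝ) < 1 + 1 / K by positivity)
      rw [h1, log_mul hK0.ne' (by positivity)]
      linarith
    have hfac : exp (K * log K - K + 1 / 2) ≤ (K.factorial : ℝ) := by
      refine le_trans ?_ (Stirling.le_factorial_stirling K)
      have h1 : exp (1 / 2) ≤ √(2 * π * K) := by
        refine le_sqrt_of_sq_le ?_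
        rw [← exp_nat_mul]
        norm_num
        nlinarith [exp_one_lt_d9, pi_gt_three]
      have h2 : (K / exp 1) ^ K = exp (K * log K - K) := by
        rw [div_pow, exp_sub, ← exp_nat_mul, mul_one, mul_comm (K : ℝ), exp_mul, exp_log hK0,
          rpow_natCast]
      rw [h2, add_comm, exp_add]
      gcongr
    rw [Finset.prod_range_succ]
    refine le_trans ?_ (mul_le_mul ih hfac (exp_pos _).le (by positivity))
    rw [← exp_add, exp_le_exp]
    have h3 : ((K + 1 : ℕ) : ℝ) * ((K + 1 : ℕ) - 1) / 2 * (log ((K + 1 : ℕ) : ℝ) - 3 / 2) ≤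
        (K + 1) * K / 2 * (log K + 1 / K - 3 / 2) := by
      push_cast at hlog ⊢
      rw [add_sub_cancel_right]
      gcongr
    refine h3.trans (le_of_eq ?_)
    field_simp
    ring

open Real in
lemma prod_pow_div_factorial_le {K : ℕ} (hK : 1 ≤ K) {A M : ℝ} (hA : 0 < A) (hM : 0 < M)
    (h : A * exp (3 / 2) ≤ M ^ 2 * K) :
    ∏ k ∈ Finset.range K, A ^ k / (k.factorial : ℝ) ≤ exp ((K : ℝ) * (K - 1) * log M) := by
  have hK1 : (1 : ℝ) ≤ K := by exact_mod_cast hK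
  have hK0 : (0 : ℝ) < K := by linarith
  have hlog : log A + 3 / 2 ≤ 2 * log M + log K := by
    have := log_le_log (by positivity) h
    rwa [log_mul hA.ne' (exp_pos _).ne', log_exp, log_mul (by positivity) hK0.ne', log_pow] at this
  rw [Finset.prod_div_distrib, Finset.prod_pow_eq_pow_sum, div_le_iff₀
    (Finset.prod_pos fun k _ => by positivity)]
  refine le_trans ?_ (mul_le_mul_of_nonneg_left (exp_le_prod_factorial hK) (exp_pos _).le)
  have hsum : ((∑ k ∈ Finset.range K, k : ℕ) : ℝ) = K * (K - 1) / 2 := by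
    have := Finset.sum_range_id_mul_two K
    have h2 : ((∑ k ∈ Finset.range K, k : ℕ) : ℝ) * 2 = K * ((K - 1 : ℕ) : ℝ) := by
      exact_mod_cast this
    rw [Nat.cast_sub hK, Nat.cast_one] at h2
    linarith
  rw [← exp_add, ← exp_log (pow_pos hA _), exp_le_exp, log_pow, hsum]
  have : 0 ≤ (K : ℝ) * (K - 1) / 2 := by
    have := sub_nonneg.mpr hK1
    positivity
  nlinarith

/-- The logarithmic form of the final numerical contradiction. -/
lemma log_inequality_false {m R L lb G : ℝ} (hm : 100 ≤ m) (hR : 14 ≤ R) (hL : 4.6 ≤ L)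
    (hlb : lb ≤ 9) (hG : G ≤ 18 * (m * R) / 1000 + 6)
    (h : 3 / 2 * (3 * m * R + 1) * L ≤
      (R - 1) * lb + (9 * m + 1) * (R + 9 / 10000) + lb * (m * R) + 3 * G) : False := by
  have h1 : 1400 ≤ m * R := by nlinarith
  have h2 : 100 * R ≤ m * R := by nlinarith
  have h3 : 14 * m ≤ m * R := by nlinarith
  have h4 : (R - 1) * lb ≤ (R - 1) * 9 := by nlinarith
  have h5 : lb * (m * R) ≤ 9 * (m * R) := by nlinarith
  have h6 : 3 / 2 * (3 * m * R + 1) * 4.6 ≤ 3 / 2 * (3 * m * R + 1) * L := by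
    gcongr
  nlinarith

section

open Real

lemma exp_seven_le : exp 7 ≤ 1100 := by
  rw [show (7 : ℝ) = (7 : ℕ) * 1 by norm_num, exp_nat_mul]
  calc exp 1 ^ 7 ≤ 2.7182818286 ^ 7 := by gcongr; exact exp_one_lt_d9.le
    _ ≤ 1100 := by norm_num

lemma le_log_hundred : 4.6 ≤ log 100 := by
  have h : log (exp 1 ^ 23) ≤ log (100 ^ 5) := by
    refine log_le_log (by positivity) ?_
    calc exp 1 ^ 23 ≤ 2.7182818286 ^ 23 := by gcongr; exact exp_one_lt_d9.le
      _ ≤ 100 ^ 5 := by norm_num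
  rw [log_pow, log_pow, log_exp] at h
  norm_num at h ⊢
  linarith

lemma log_hundred_le : log 100 ≤ 4.625 := by
  have h : log (100 ^ 8) ≤ log (exp 1 ^ 37) := by
    refine log_le_log (by positivity) ?_
    calc (100 : ℝ) ^ 8 ≤ 2.7182818283 ^ 37 := by norm_num
      _ ≤ exp 1 ^ 37 := by gcongr; exact exp_one_gt_d9.le
  rw [log_pow, log_pow, log_exp] at h
  norm_num at h ⊢
  linarith

lemma log_thousand_le : log 1000 ≤ 7 := by
  rw [log_le_iff_le_exp (by norm_num), show (7 : ℝ) = (7 : ℕ) * 1 by norm_num, exp_nat_mul]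
  calc (1000 : ℝ) ≤ 2.7182818283 ^ 7 := by norm_num
    _ ≤ exp 1 ^ 7 := by gcongr; exact exp_one_gt_d9.le

lemma log_le_nine {β : ℝ} (h0 : 0 < β) (h : β ≤ 6750) : log β ≤ 9 := by
  rw [log_le_iff_le_exp h0, show (9 : ℝ) = (9 : ℕ) * 1 by norm_num, exp_nat_mul]
  calc β ≤ 2.7182818283 ^ 9 := h.trans (by norm_num)
    _ ≤ exp 1 ^ 9 := by gcongr; exact exp_one_gt_d9.le

lemma exp_three_halves_le : exp (3 / 2) ≤ 4.5 := by
  refine (sq_le_sq₀ (exp_pos _).le (by norm_num)).mp ?_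
  rw [← exp_nat_mul, show ((2 : ℕ) : ℝ) * (3 / 2) = (3 : ℕ) * 1 by norm_num, exp_nat_mul]
  calc exp 1 ^ 3 ≤ 2.7182818286 ^ 3 := by gcongr; exact exp_one_lt_d9.le
    _ ≤ 4.5 ^ 2 := by norm_num

lemma log_le_div_add_log {x a : ℝ} (hx : 0 < x) (ha : 0 < a) : log x ≤ x / a - 1 + log a := by
  have := log_le_sub_one_of_pos (div_pos hx ha)
  rw [log_div hx.ne' ha.ne'] at this
  linarith

/-- The smallness condition on `κ` in the interpolation estimate. -/
lemma pow_mul_le_one {m R ℓ : ℕ} {w κ : ℝ} (hm : 100 ≤ m) (hmℓ : m ^ 2 ≤ ℓ) (hw : 7 ≤ w)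
    (hR : (R : ℝ) ≤ 2 * w + 1) (hκ0 : 0 ≤ κ) (hκ : κ ≤ exp (-(ℓ * w))) :
    (m : ℝ) ^ (3 * m * R * 3) * (2 * (κ * ((9 * m + 2 : ℕ) : ℝ))) ≤ 1 := by
  have hm' : (100 : ℝ) ≤ m := by exact_mod_cast hm
  have hm0 : (0 : ℝ) < m := by linarith
  have hmℓ' : (m : ℝ) ^ 2 ≤ ℓ := by exact_mod_cast hmℓ
  have hL : log m ≤ 0.04625 * m := by
    have := log_le_div_add_log hm0 (show (0 : ℝ) < 100 by norm_num)
    linarith [log_hundred_le]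
  have h2 : 2 * ((9 * m + 2 : ℕ) : ℝ) ≤ (m : ℝ) ^ 2 := by push_cast; nlinarith
  have hmain : ((3 * m * R * 3 : ℕ) : ℝ) * log m + 2 * log m ≤ ℓ * w := by
    have h3 : ((3 * m * R * 3 : ℕ) : ℝ) + 2 ≤ 9 * m * (15 / 7 * w) + 2 := by
      push_cast
      nlinarith
    have hL0 : 0 ≤ log m := log_nonneg (by linarith)
    calc ((3 * m * R * 3 : ℕ) : ℝ) * log m + 2 * log m
        = (((3 * m * R * 3 : ℕ) : ℝ) + 2) * log m := by ring
      _ ≤ (9 * m * (15 / 7 * w) + 2) * (0.04625 * m) := by gcongr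
      _ ≤ m ^ 2 * w := by nlinarith [mul_le_mul hm' hw (by norm_num) hm0.le]
      _ ≤ ℓ * w := by gcongr
  calc (m : ℝ) ^ (3 * m * R * 3) * (2 * (κ * ((9 * m + 2 : ℕ) : ℝ)))
      = (m : ℝ) ^ (3 * m * R * 3) * (2 * ((9 * m + 2 : ℕ) : ℝ)) * κ := by ring
    _ ≤ (m : ℝ) ^ (3 * m * R * 3) * (m : ℝ) ^ 2 * exp (-(ℓ * w)) := by gcongr
    _ = exp (((3 * m * R * 3 : ℕ) : ℝ) * log m + 2 * log m - ℓ * w) := by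
      rw [sub_eq_add_neg, exp_add, exp_add, mul_comm _ (log (m : ℝ)), mul_comm 2, exp_mul,
        exp_mul, exp_log hm0, rpow_natCast, rpow_two]
    _ ≤ 1 := by
      rw [exp_le_one_iff]
      linarith

lemma log_nat_factorial_le (N : ℕ) : log (N.factorial : ℝ) ≤ N * log N := by
  rw [← log_pow]
  refine log_le_log (by positivity) ?_
  exact_mod_cast Nat.factorial_le_pow N

/-- The logarithm of the interpolation inequality. -/
lemma log_interpolation_inequality {K R S β X B : ℕ} {ρ Y μ : ℝ} (hK : 1 ≤ K) (hR : 1 ≤ R)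
    (hβ : 0 < β) (hX : 0 < X) (hB : 0 < B) (hρ : 1 ≤ ρ) (hY : 0 < Y)
    (hA : (ρ + 1) * Y * exp (3 / 2) ≤ ρ ^ 2 * K)
    (h : ρ ^ (K * 3 * (K * 3 - 1) / 2) ≤
      ((β : ℝ) ^ (R - 1) * X ^ (S + 1) * B ^ (S + 1)) ^ K * ((K * 3).factorial *
        (2 ^ (K * 3) * (∏ k ∈ Finset.range K, ((ρ + 1) * Y) ^ k / k.factorial) ^ 3 *
          exp (2 * K * (μ * (ρ * Y)))))) :
    3 / 2 * (K + 1) * log ρ ≤ (R - 1) * log β + (S + 1) * (log X + log B) +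
      2 * (μ * (ρ * Y)) + 3 * log (6 * K) := by
  have hρ0 : 0 < ρ := by linarith
  have hK1 : (1 : ℝ) ≤ K := by exact_mod_cast hK
  have hβ' : (0 : ℝ) < β := by exact_mod_cast hβ
  have hX' : (0 : ℝ) < X := by exact_mod_cast hX
  have hB' : (0 : ℝ) < B := by exact_mod_cast hB
  set P := ∏ k ∈ Finset.range K, ((ρ + 1) * Y) ^ k / (k.factorial : ℝ) with hPdef
  have hP0 : 0 < P := Finset.prod_pos fun k _ => by positivity
  have hP : log P ≤ K * (K - 1) * log ρ := by
    rw [log_le_iff_le_exp hP0]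
    exact prod_pow_div_factorial_le hK (by positivity) hρ0 hA
  have hexp : ((K * 3 * (K * 3 - 1) / 2 : ℕ) : ℝ) = K * 3 * (K * 3 - 1) / 2 := by
    rw [Nat.cast_div_charZero (even_iff_two_dvd.mp (Nat.even_mul_pred_self _))]
    push_cast [Nat.cast_sub (show 1 ≤ K * 3 by omega)]
    ring
  have hf0 : ((K * 3).factorial : ℝ) ≠ 0 := by positivity
  have hlog := log_le_log (by positivity) h
  rw [log_pow, hexp, log_mul (by positivity) (by positivity), log_mul hf0 (by positivity),
    log_mul (by positivity) (by positivity), log_mul (by positivity) (by positivity), log_exp,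
    log_pow, log_pow, log_pow, log_mul (by positivity) (by positivity),
    log_mul (by positivity) (by positivity), log_pow, log_pow, log_pow] at hlog
  have hfac := log_nat_factorial_le (K * 3)
  have h6 : log (6 * (K : ℝ)) = log ((K * 3 : ℕ) : ℝ) + log 2 := by
    rw [← log_mul (by positivity) (by norm_num)]
    push_cast
    ring_nf
  rw [h6]
  push_cast [Nat.cast_sub hR] at hlog hfac ⊢
  refine le_of_mul_le_mul_left ?_ (show (0 : ℝ) < K by linarith)
  nlinarith

lemma no_solution_of_parameters {ℓ m R β X B : ℕ} {κ : ℝ} (hm : 100 ≤ m) (hmℓ : m ^ 2 ≤ ℓ)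
    (hℓm : ℓ < (m + 1) ^ 2) (hR1 : 2 * log B ≤ R) (hR2 : (R : ℝ) ≤ 2 * log B + 1)
    (hw : 7 ≤ log B) (hβ : 0 < β) (hβ9 : log β ≤ 9) (hXB : B < X)
    (hκ0 : 0 ≤ κ) (hκ : κ ≤ exp (-(ℓ * log B)))
    (hα : log (X / B : ℝ) = log β / ℓ - κ) : False := by
  have hB : 0 < B := by
    rcases Nat.eq_zero_or_pos B with rfl | h
    · norm_num at hw
    · exact h
  have hX : 0 < X := hB.trans hXB
  have hR14' : (14 : ℝ) ≤ R := by linarith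
  have hR14 : 14 ≤ R := by exact_mod_cast hR14'
  have hℓ : 10000 ≤ ℓ := by nlinarith
  have hℓ' : (10000 : ℝ) ≤ ℓ := by exact_mod_cast hℓ
  have hℓ0 : (0 : ℝ) < ℓ := by linarith
  have hm' : (100 : ℝ) ≤ m := by exact_mod_cast hm
  have hmℓ' : (m : ℝ) ^ 2 ≤ ℓ := by exact_mod_cast hmℓ
  have hℓm' : (ℓ : ℝ) ≤ (m + 1) ^ 2 := by exact_mod_cast hℓm.le
  have hβ' : (0 : ℝ) < β := by exact_mod_cast hβ
  have hB' : (0 : ℝ) < B := by exact_mod_cast hB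
  have hX' : (0 : ℝ) < X := by exact_mod_cast hX
  have hlogβ : 0 ≤ log β := log_natCast_nonneg β
  have hμ : 0 ≤ log β / ℓ := by positivity
  have hineq := interpolation_inequality (ℓ := ℓ) (K := 3 * m * R) (R := R) (S := 9 * m) (β := β)
    (X := X) (B := B) (μ := log β / ℓ) (κ := κ) (ρ := m) (Y := ℓ * R / 2) (by nlinarith)
    (by nlinarith) hβ hB hXB (by rw [mul_div_cancel₀ _ hℓ0.ne', exp_log hβ'])
    (by rw [← hα, exp_log (by positivity)]) hμ hκ0 (by linarith)
    (by
      push_cast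
      have : (3 * m : ℝ) ≤ ℓ := by nlinarith
      nlinarith)
    (by push_cast; linarith) (pow_mul_le_one hm hmℓ hw hR2 hκ0 hκ)
  have hlog := log_interpolation_inequality (by nlinarith) (by omega) hβ hX hB (by linarith)
    (by positivity) (by
      push_cast
      calc ((m : ℝ) + 1) * (ℓ * R / 2) * exp (3 / 2)
          ≤ ((m : ℝ) + 1) * ((m + 1) ^ 2 * R / 2) * 4.5 := by
            gcongr
            exact exp_three_halves_le
        _ = 2.25 * (m + 1) ^ 3 * R := by ring
        _ ≤ (3 * m ^ 3) * R := by
            refine mul_le_mul_of_nonneg_right ?_ (by positivity)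
            nlinarith [mul_nonneg (sub_nonneg.mpr hm') (sub_nonneg.mpr hm'),
              mul_nonneg (mul_nonneg (sub_nonneg.mpr hm') (sub_nonneg.mpr hm'))
                (sub_nonneg.mpr hm')]
        _ = m ^ 2 * (3 * m * R) := by ring) hineq
  have hlogX : log X ≤ log B + 9 / 10000 := by
    rw [log_div hX'.ne' hB'.ne'] at hα
    have : log β / ℓ ≤ 9 / 10000 := by gcongr
    linarith
  have hm0 : (0 : ℝ) < m := by linarith
  have hG := log_le_div_add_log (show (0 : ℝ) < 18 * (m * R) by positivity)
    (show (0 : ℝ) < 1000 by norm_num)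
  refine log_inequality_false hm' hR14' (le_log_hundred.trans (log_le_log (by norm_num) hm')) hβ9
    (G := log (18 * (m * R))) (by linarith [log_thousand_le]) ?_
  have h1 : 2 * (log β / ℓ * (m * (ℓ * R / 2))) = log β * (m * R) := by field_simp
  have h2 : (6 : ℝ) * ((3 * m * R : ℕ) : ℝ) = 18 * (m * R) := by push_cast; ring
  rw [h1, h2] at hlog
  push_cast at hlog
  have h3 : (9 * (m : ℝ) + 1) * (log X + log B) ≤ (9 * m + 1) * (R + 9 / 10000) :=
    mul_le_mul_of_nonneg_left (by linarith) (by positivity)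
  linarith

/-- For large exponents the approximation `X / B` to the root of `β` would be too good. -/
lemma no_solution_of_le {ℓ β c X B : ℕ} (hℓ : 10000 ≤ ℓ) (hβ2 : 2 ≤ β) (hβ : β ≤ 6750)
    (hc : c ≤ ℓ) (hB2 : 2 ≤ B) : X ^ ℓ + c ≠ β * B ^ ℓ := by
  intro h
  have hcB : c < B ^ ℓ :=
    hc.trans_lt ((Nat.lt_two_pow_self).trans_le (Nat.pow_le_pow_left hB2 ℓ))
  have hXB : B < X := by
    by_contra hle
    have h1 : X ^ ℓ ≤ B ^ ℓ := Nat.pow_le_pow_left (not_lt.mp hle) ℓ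
    nlinarith
  have hB' : (0 : ℝ) < B := by
    have : 0 < B := by omega
    exact_mod_cast this
  have hXB' : (B : ℝ) + 1 ≤ X := by exact_mod_cast hXB
  have hX' : (0 : ℝ) < X := by linarith
  have hβ' : (0 : ℝ) < β := by
    have : 0 < β := by omega
    exact_mod_cast this
  have hℓ' : (10000 : ℝ) ≤ ℓ := by exact_mod_cast hℓ
  have hℓ0 : (0 : ℝ) < ℓ := by linarith
  have hβ9 : log β ≤ 9 := log_le_nine hβ' (by exact_mod_cast hβ)
  have hreal : (X : ℝ) ^ ℓ + c = β * (B : ℝ) ^ ℓ := by exact_mod_cast h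
  have hfrac : (β : ℝ) * B ^ ℓ / X ^ ℓ = 1 + c / X ^ ℓ := by
    rw [← hreal, add_div, div_self (by positivity)]
  have hlogfrac : log ((β : ℝ) * B ^ ℓ / X ^ ℓ) = log β - ℓ * log (X / B : ℝ) := by
    rw [log_div (by positivity) (by positivity), log_mul (by positivity) (by positivity),
      log_pow, log_pow, log_div hX'.ne' hB'.ne']
    ring
  have hκ0 : 0 ≤ log β - ℓ * log (X / B : ℝ) := by
    rw [← hlogfrac, hfrac]
    exact log_nonneg (le_add_of_nonneg_right (by positivity))
  have hκ : log β - ℓ * log (X / B : ℝ) ≤ ℓ * exp (-(ℓ * log B)) := by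
    rw [← hlogfrac, hfrac]
    have h1 := log_le_sub_one_of_pos (show (0 : ℝ) < 1 + c / X ^ ℓ by positivity)
    have h2 : (c : ℝ) / X ^ ℓ ≤ ℓ / B ^ ℓ := by
      have : (c : ℝ) ≤ ℓ := by exact_mod_cast hc
      have : (B : ℝ) ≤ X := by linarith
      gcongr
    rw [exp_neg, mul_comm (ℓ : ℝ) (log B), exp_mul, exp_log hB', rpow_natCast, ← div_eq_mul_inv]
    linarith
  have hw : 7 ≤ log B := by
    have h1 := one_sub_inv_le_log_of_pos (div_pos hX' hB')
    have h2 : (1 : ℝ) / (B + 1) ≤ 1 - (X / B : ℝ)⁻¹ := by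
      rw [inv_div, div_le_iff₀ (by positivity)]
      have : (B : ℝ) / X ≤ B / (B + 1) := by gcongr
      have h3 : (B : ℝ) / (B + 1) * (B + 1) = B := by field_simp
      nlinarith
    have h4 : log (X / B : ℝ) ≤ 9 / 10000 := by nlinarith
    have h5 : (1 : ℝ) / (B + 1) ≤ 9 / 10000 := by linarith
    rw [div_le_div_iff₀ (by positivity) (by norm_num)] at h5
    rw [le_log_iff_exp_le hB']
    linarith [exp_seven_le]
  refine no_solution_of_parameters (ℓ := ℓ) (m := ℓ.sqrt) (R := ⌈2 * log B⌉₊) (β := β) (X := X)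
    (B := B) (κ := log β / ℓ - log (X / B : ℝ)) ?_ ?_ ?_ (Nat.le_ceil _)
    (Nat.ceil_lt_add_one (by linarith)).le hw (by omega) hβ9 hXB ?_ ?_ (by ring)
  · rw [Nat.le_sqrt]
    omega
  · exact Nat.sqrt_le' ℓ
  · exact Nat.lt_succ_sqrt' ℓ
  · rw [sub_nonneg, le_div_iff₀ hℓ0]
    linarith
  · rw [sub_le_iff_le_add, div_le_iff₀ hℓ0]
    linarith

end

/-- The descent for `s * (s ^ 2 + 15) = 2 * y ^ ℓ`: the two factors are powers up to their
greatest common divisor, a divisor of `15`. -/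
lemma exists_descent {ℓ s u y : ℕ} (hu : 2 * u = s ^ 2 + 15) (h : s * u = y ^ ℓ) :
    ∃ g t B : ℕ, g ∈ [1, 3, 5, 15] ∧ s * g = t ^ ℓ ∧ u = g * B ^ ℓ := by
  have hg15 : Nat.gcd s u ∣ 15 := by
    have h1 : Nat.gcd s u ∣ s ^ 2 + 15 := hu ▸ (Nat.gcd_dvd_right s u).mul_left 2
    exact (Nat.dvd_add_right ((Nat.gcd_dvd_left s u).pow two_ne_zero)).mp h1
  have hgs := Nat.gcd_dvd_left s u
  obtain ⟨v, hv⟩ := Nat.gcd_dvd_right s u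
  set g := Nat.gcd s u with hg
  have hmem : g ∈ [1, 3, 5, 15] := by
    have : g ∈ Nat.divisors 15 := by simpa using hg15
    rw [show Nat.divisors 15 = {1, 3, 5, 15} by decide] at this
    simpa using this
  have hcop : Nat.Coprime s v := by
    rw [Nat.coprime_iff_gcd_eq_one]
    by_contra hne
    obtain ⟨p, hp, hpd⟩ := Nat.exists_prime_and_dvd hne
    have hps := hpd.trans (Nat.gcd_dvd_left _ _)
    have hpv := hpd.trans (Nat.gcd_dvd_right _ _)
    have hpg : p ∣ g := Nat.dvd_gcd hps (hv ▸ hpv.mul_left g)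
    have hp15 : p ^ 2 ∣ 15 := by
      have h1 : p ^ 2 ∣ s ^ 2 + 15 := by
        rw [← hu, hv, sq]
        exact (mul_dvd_mul hpg hpv).mul_left 2
      exact (Nat.dvd_add_right (pow_dvd_pow_of_dvd hps 2)).mp h1
    have hple : p ≤ 3 := by
      have := Nat.le_of_dvd (by norm_num) hp15
      nlinarith
    have := hp.two_le
    interval_cases p <;> omega
  have hcop' : Nat.Coprime (s * g) v := hcop.mul_left (hcop.coprime_dvd_left hgs)
  have hprod : s * g * v = y ^ ℓ := by rw [← h, hv]; ring
  obtain ⟨t, ht⟩ := exists_eq_pow_of_mul_eq_pow (Nat.isUnit_iff.mpr hcop') hprod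
  obtain ⟨B, hB⟩ := exists_eq_pow_of_mul_eq_pow (Nat.isUnit_iff.mpr hcop'.symm)
    ((mul_comm _ _).trans hprod)
  exact ⟨g, t, B, hmem, ht, by rw [← hB]; exact hv⟩

lemma exists_eq_mul_pow_of_descent {ℓ s g t : ℕ} (hg : g ∈ [1, 3, 5, 15])
    (ht : s * g = t ^ (ℓ + 1)) : ∃ A, s = g ^ ℓ * A ^ (ℓ + 1) := by
  have hsq : Squarefree g := by
    simp only [List.mem_cons, List.not_mem_nil, or_false] at hg
    rcases hg with rfl | rfl | rfl | rfl <;> decide +kernel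
  have hg0 : 0 < g := Nat.pos_of_ne_zero hsq.ne_zero
  obtain ⟨A, rfl⟩ := (hsq.dvd_pow_iff_dvd (Nat.succ_ne_zero ℓ)).mp (ht ▸ Dvd.intro_left s rfl)
  refine ⟨A, Nat.eq_of_mul_eq_mul_right hg0 ?_⟩
  rw [ht]
  ring

lemma no_square_solution {s u y : ℕ} (hs : Odd s) (hs7 : 7 ≤ s) (hu : 2 * u = s ^ 2 + 15) :
    s * u ≠ y ^ 2 := by
  intro h
  obtain ⟨g, t, B, hg, ht, hB⟩ := exists_descent hu h
  obtain ⟨A, hA⟩ := exists_eq_mul_pow_of_descent hg ht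
  have hAodd : Odd (A : ℤ) := by
    rw [hA] at hs
    exact_mod_cast (Nat.odd_pow_iff two_ne_zero).mp (Nat.odd_mul.mp hs).2
  have hu' : 2 * ((g : ℤ) * (B : ℤ) ^ 2) = (g * A ^ 2) ^ 2 + 15 := by
    rw [hB, hA, pow_one] at hu
    exact_mod_cast hu
  have hA8 : (A : ℤ) ^ 4 % 8 = 1 := by
    rw [show (A : ℤ) ^ 4 = (A ^ 2) * (A ^ 2) by ring, Int.mul_emod,
      Int.sq_emod_eight_of_odd (Int.odd_iff.mp hAodd)]
    norm_num
  have hA1 (h1 : (A : ℤ) ^ 2 = 1) : s = g := by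
    have : A ^ 2 = 1 := by exact_mod_cast h1
    rw [hA, this, pow_one, mul_one]
  have heven (h4 : (4 : ℤ) ∣ (B : ℤ) ^ 2) : ∃ C : ℤ, (B : ℤ) = 2 * C :=
    (Int.pow_dvd_pow_iff two_ne_zero).mp (by norm_num; exact h4)
  simp only [List.mem_cons, List.not_mem_nil, or_false] at hg
  rcases hg with rfl | rfl | rfl | rfl
  · have hmod := congrArg (Int.cast : ℤ → ZMod 9) hu'
    push_cast at hmod
    exact (by decide +kernel : ∀ a b : ZMod 9, 2 * (1 * b ^ 2) ≠ (1 * a ^ 2) ^ 2 + 15) _ _ hmod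
  · obtain ⟨C, hC⟩ := heven (by push_cast at hu'; ring_nf at hu'; omega)
    have := hA1 (sq_eq_one_of_three_mul_pow_four_add (C := C) (by
      rw [hC] at hu'
      push_cast at hu'
      linarith))
    omega
  · obtain ⟨C, hC⟩ := heven (by push_cast at hu'; ring_nf at hu'; omega)
    have := hA1 (sq_eq_one_of_five_mul_pow_four_add (C := C) (by
      rw [hC] at hu'
      push_cast at hu'
      linarith))
    omega
  · have hmod := congrArg (Int.cast : ℤ → ZMod 9) hu'
    push_cast at hmod
    exact (by decide +kernel : ∀ a b : ZMod 9, 2 * (15 * b ^ 2) ≠ (15 * a ^ 2) ^ 2 + 15) _ _ hmod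

lemma eq_of_cube_solution {s u y : ℕ} (hs7 : 7 ≤ s) (hu : 2 * u = s ^ 2 + 15)
    (h : s * u = y ^ 3) : s = 25 := by
  obtain ⟨g, t, B, hg, ht, hB⟩ := exists_descent hu h
  obtain ⟨A, hA⟩ := exists_eq_mul_pow_of_descent hg ht
  have hu' : 2 * ((g : ℤ) * (B : ℤ) ^ 3) = (g ^ 2 * A ^ 3) ^ 2 + 15 := by
    rw [hB, hA] at hu
    exact_mod_cast hu
  simp only [List.mem_cons, List.not_mem_nil, or_false] at hg
  rcases hg with rfl | rfl | rfl | rfl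
  · have hA1 := eq_one_of_cube_add_fifteen (X := (A : ℤ) ^ 2) (B := B) (by
      push_cast at hu'
      linarith)
    have : A = 1 := by
      have : A ^ 2 = 1 := by exact_mod_cast hA1
      simpa using this
    rw [hA, this] at hs7
    omega
  · have hmod := congrArg (Int.cast : ℤ → ZMod 27) hu'
    push_cast at hmod
    refine absurd hmod ?_
    generalize (A : ZMod 27) = a
    generalize (B : ZMod 27) = b
    revert a b
    decide +kernel
  · have hA5 := (eq_five_of_cube_add_three (X := 5 * (A : ℤ) ^ 2) (B := B) (by
      push_cast at hu'
      linarith) (Dvd.intro _ rfl)).1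
    have : A = 1 := by
      have : A ^ 2 = 1 := by
        have : (A : ℤ) ^ 2 = 1 := by linarith
        exact_mod_cast this
      simpa using this
    rw [hA, this]
    norm_num
  · have hmod := congrArg (Int.cast : ℤ → ZMod 27) hu'
    push_cast at hmod
    refine absurd hmod ?_
    generalize (A : ZMod 27) = a
    generalize (B : ZMod 27) = b
    revert a b
    decide +kernel

lemma no_solution_of_five_le {ℓ s u y : ℕ} (hℓ : ℓ.Prime) (h5 : 5 ≤ ℓ) (hs7 : 7 ≤ s)
    (hu : 2 * u = s ^ 2 + 15) : s * u ≠ y ^ ℓ := by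
  intro h
  obtain ⟨g, t, B, hg, ht, hB⟩ := exists_descent hu h
  have heq : (t ^ 2) ^ ℓ + 15 * g ^ 2 = 2 * g ^ 3 * B ^ ℓ := by
    rw [← pow_mul, mul_comm 2 ℓ, pow_mul, ← ht]
    rw [hB] at hu
    calc (s * g) ^ 2 + 15 * g ^ 2 = g ^ 2 * (s ^ 2 + 15) := by ring
      _ = 2 * g ^ 3 * B ^ ℓ := by rw [← hu]; ring
  have hβc : (2 * g ^ 3, 15 * g ^ 2) ∈ [(2, 15), (54, 135), (250, 375), (6750, 3375)] := by
    simp only [List.mem_cons, List.not_mem_nil, or_false] at hg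
    rcases hg with rfl | rfl | rfl | rfl <;> simp
  rcases lt_or_ge ℓ 10000 with hlt | hge
  · exact no_solution_of_lt hℓ h5 hlt hβc t B heq
  · have hg15 : 1 ≤ g ∧ g ≤ 15 := by
      simp only [List.mem_cons, List.not_mem_nil, or_false] at hg
      omega
    refine no_solution_of_le hge ?_ ?_ ?_ ?_ heq
    · have := Nat.pow_le_pow_left hg15.1 3
      omega
    · have := Nat.pow_le_pow_left hg15.2 3
      omega
    · have := Nat.pow_le_pow_left hg15.2 2
      omega
    · by_contra hlt
      have hle : B ^ ℓ ≤ 1 := pow_le_one₀ (Nat.zero_le B) (by omega)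
      nlinarith

/-- The only solution in integers `x ≥ 1`, `y` to
`(x+1)³ + (x+2)³ + (x+3)³ + (x+4)³ = yˡ` with `ℓ` prime is
`(x, y, ℓ) = (10, 20, 3)`, i.e. `11³ + 12³ + 13³ + 14³ = 20³`. -/
theorem sum_four_consecutive_cubes_perfect_power (ℓ : ℕ) (hℓ : ℓ.Prime)
    (x y : ℤ) (hx : 1 ≤ x) :
    (x + 1) ^ 3 + (x + 2) ^ 3 + (x + 3) ^ 3 + (x + 4) ^ 3 = y ^ ℓ ↔
      (x = 10 ∧ y = 20 ∧ ℓ = 3) := by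
  constructor
  · intro h
    lift x to ℕ using by linarith
    have hx1 : 1 ≤ x := by exact_mod_cast hx
    have hs : Odd (2 * x + 5) := ⟨x + 2, by ring⟩
    have hu : 2 * (2 * x ^ 2 + 10 * x + 20) = (2 * x + 5) ^ 2 + 15 := by ring
    have hy : (2 * x + 5) * (2 * x ^ 2 + 10 * x + 20) = y.natAbs ^ ℓ := by
      rw [← Int.natAbs_pow, ← h]
      zify
      rw [abs_of_nonneg (by positivity)]
      ring
    rcases Nat.lt_or_ge ℓ 5 with hlt | hge
    · have h2 := hℓ.two_le
      interval_cases ℓ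
      · exact absurd hy (no_square_solution hs (by omega) hu)
      · have hx10 : x = 10 := by
          have := eq_of_cube_solution (by omega) hu hy
          omega
        subst hx10
        refine ⟨rfl, ?_, rfl⟩
        have h20 : y ^ 3 = 20 ^ 3 := by rw [← h]; norm_num
        exact (show Odd 3 by decide).strictMono_pow.injective h20
      · exact absurd hℓ (by norm_num)
    · exact absurd hy (no_solution_of_five_le hℓ hge (by omega) hu)
  · rintro ⟨rfl, rfl, rfl⟩
    norm_num
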